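/- For every positive integer n, the number of representations of n by x1^2 + x2^2 + x3^2 + x4^2 + x5^2 + 2x6^2 + 4(x7^2+x8^2) equals (32/11)σ_{3;χ8,1}(n) + (2/11)σ_{3;1,χ8}(n/2) − (14/11)a1(n) + (92/11)a2(n) + (224/11)a1(n/2) + (192/11)a2(n/2), with terms of non-integer argument interpreted as 0. -/

import Mathlib

open Complex Real Finset

/-- The Dedekind eta function `η(z) = q^{1/24} ∏ (1 - q^m)`, `q = e^{2πiz}`. -/
noncomputable def dedekindEta (z : ℂ) : ℂ :=
  Complex.exp (Real.pi * Complex.I * z / 12) *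
    ∏' m : ℕ, (1 - Complex.exp (2 * Real.pi * Complex.I * (m + 1) * z))

/-- `repCount a n` is the number of `(x₁,…,x₈) ∈ ℤ⁸` with `∑ aᵢ xᵢ² = n`. -/
noncomputable def repCount (a : Fin 8 → ℕ) (n : ℕ) : ℕ :=
  Nat.card {x : Fin 8 → ℤ // ∑ i, (a i : ℤ) * x i ^ 2 = (n : ℤ)}

/-- `σ_{3;1,χ₈}(n) = ∑_{d ∣ n} χ₈(d) d³`. -/
def sigmaOneChi8 (n : ℕ) : ℤ := ∑ d ∈ n.divisors, ZMod.χ₈ (d : ZMod 8) * (d : ℤ) ^ 3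

/-- `σ_{3;χ₈,1}(n) = ∑_{d ∣ n} χ₈(n/d) d³`. -/
def sigmaChi8One (n : ℕ) : ℤ := ∑ d ∈ n.divisors, ZMod.χ₈ ((n / d : ℕ) : ZMod 8) * (d : ℤ) ^ 3

/-- `f(n/2)` when `2 ∣ n`, and `0` otherwise. -/
def half (f : ℕ → ℤ) (n : ℕ) : ℚ := if 2 ∣ n then (f (n / 2) : ℚ) else 0

namespace Rep10
open Filter Topology

/-! ### Basic summability over the integers -/

lemma summable_int_pow_mul_geom (k : ℕ) {Q : ℝ} (h0 : 0 < Q) (h1 : Q < 1) :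
    Summable fun n : ℤ => |(n : ℝ)| ^ k * Q ^ n.natAbs := by
  have hs := summable_pow_mul_geometric_of_norm_lt_one (R := ℝ) k (r := Q)
    (by rw [Real.norm_of_nonneg h0.le]; exact h1)
  apply Summable.of_nat_of_neg
  · simpa using hs
  · simpa using hs

lemma summable_int_geom {Q : ℝ} (h0 : 0 < Q) (h1 : Q < 1) :
    Summable fun n : ℤ => Q ^ n.natAbs := by
  simpa using summable_int_pow_mul_geom 0 h0 h1

lemma zpow_le_of_bounds {Q y : ℝ} (h0 : 0 < Q) (hy : Q ≤ y) (hy' : y ≤ Q⁻¹) (n : ℤ) :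
    y ^ n ≤ (Q ^ n.natAbs)⁻¹ := by
  have hy0 : 0 < y := lt_of_lt_of_le h0 hy
  rcases Int.natAbs_eq n with h | h
  · conv_lhs => rw [h]
    rw [zpow_natCast, ← inv_pow]
    exact pow_le_pow_left₀ hy0.le hy' _
  · conv_lhs => rw [h]
    rw [zpow_neg, zpow_natCast]
    exact inv_anti₀ (by positivity) (pow_le_pow_left₀ h0.le hy _)

lemma theta_term_le {Q y : ℝ} (h0 : 0 < Q) (h1 : Q < 1) (hy : Q ≤ y) (hy' : y ≤ Q⁻¹) (n : ℤ) :
    Q ^ (n ^ 2) * y ^ n ≤ Q⁻¹ * Q ^ n.natAbs := by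
  have hb := zpow_le_of_bounds h0 hy hy' n
  have hn : (n ^ 2 : ℤ) = ((n.natAbs ^ 2 : ℕ) : ℤ) := by push_cast; simp
  calc Q ^ (n ^ 2) * y ^ n ≤ Q ^ (n ^ 2) * (Q ^ n.natAbs)⁻¹ := by gcongr
    _ = Q ^ ((n.natAbs : ℤ) ^ 2 - n.natAbs) := by
        rw [zpow_sub₀ h0.ne', zpow_natCast Q n.natAbs, div_eq_mul_inv, hn]; push_cast; rfl
    _ ≤ Q ^ ((n.natAbs : ℤ) - 1) := by
        apply zpow_le_zpow_right_of_le_one₀ h0 h1.le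
        nlinarith [sq_nonneg ((n.natAbs : ℤ) - 1)]
    _ = Q⁻¹ * Q ^ n.natAbs := by
        rw [zpow_sub₀ h0.ne', zpow_natCast, zpow_one, div_eq_mul_inv, mul_comm]

lemma summable_theta_norm {Q : ℝ} {x : ℂ} (h0 : 0 < Q) (h1 : Q < 1) (hy : Q ≤ ‖x‖)
    (hy' : ‖x‖ ≤ Q⁻¹) : Summable fun n : ℤ => ‖((Q : ℂ) ^ (n ^ 2) * x ^ n)‖ := by
  refine Summable.of_nonneg_of_le (fun _ => norm_nonneg _) (fun n => ?_)
    ((summable_int_geom h0 h1).mul_left Q⁻¹)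
  rw [norm_mul, norm_zpow, norm_zpow, Complex.norm_real, Real.norm_of_nonneg h0.le]
  exact theta_term_le h0 h1 hy hy' n

/-! ### The Jacobi triple product -/

/-- finite q-Pochhammer product -/
noncomputable def P (y : ℝ) (n : ℕ) : ℝ := ∏ i ∈ Finset.range n, (1 - y ^ (i + 1))

/-- reciprocal of the Pochhammer product, zero at negative indices -/
noncomputable def ip (y : ℝ) (j : ℤ) : ℝ := if j < 0 then 0 else (P y j.toNat)⁻¹

lemma one_sub_pow_pos {y : ℝ} (h0 : 0 < y) (h1 : y < 1) (i : ℕ) : 0 < 1 - y ^ (i + 1) :=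
  sub_pos.2 (pow_lt_one₀ h0.le h1 (by omega))

lemma P_pos {y : ℝ} (h0 : 0 < y) (h1 : y < 1) (n : ℕ) : 0 < P y n :=
  Finset.prod_pos fun i _ => one_sub_pow_pos h0 h1 i

lemma P_succ (y : ℝ) (n : ℕ) : P y (n + 1) = P y n * (1 - y ^ (n + 1)) :=
  Finset.prod_range_succ _ _

lemma ip_pred {y : ℝ} (h0 : 0 < y) (h1 : y < 1) (j : ℤ) : ip y (j - 1) = (1 - y ^ j) * ip y j := by
  unfold ip
  rcases lt_trichotomy j 0 with h | h | h
  · rw [if_pos h, if_pos (by omega), mul_zero]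
  · subst h; simp
  · rw [if_neg (by omega), if_neg (by omega)]
    obtain ⟨n, rfl⟩ : ∃ n : ℕ, j = (n : ℤ) + 1 := ⟨(j - 1).toNat, by omega⟩
    have e1 : ((n : ℤ) + 1 - 1).toNat = n := by omega
    have e2 : ((n : ℤ) + 1).toNat = n + 1 := by omega
    rw [e1, e2, P_succ]
    have := P_pos h0 h1 n
    have h2 := one_sub_pow_pos h0 h1 n
    have e3 : y ^ ((n : ℤ) + 1) = y ^ (n + 1) := by
      rw [← zpow_natCast]; push_cast; rfl
    rw [e3]
    field_simp

/-- coefficients in the finite triple product -/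
noncomputable def cc (Q : ℝ) (N : ℕ) (k : ℤ) : ℝ :=
  P (Q ^ 2) (2 * N) * ip (Q ^ 2) (N + k) * ip (Q ^ 2) (N - k) * Q ^ (k ^ 2)

lemma cc_succ {Q : ℝ} (h0 : 0 < Q) (h1 : Q < 1) (N : ℕ) (k : ℤ) :
    cc Q (N + 1) k = (1 + Q ^ (2 * (2 * N + 1))) * cc Q N k +
      Q ^ (2 * N + 1) * (cc Q N (k - 1) + cc Q N (k + 1)) := by
  have hy0 : 0 < Q ^ 2 := by positivity
  have hy1 : Q ^ 2 < 1 := by nlinarith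
  unfold cc
  have a1 : ip (Q ^ 2) ((N : ℤ) + k) = (1 - (Q ^ 2) ^ ((N : ℤ) + k + 1)) * ip (Q ^ 2) (N + k + 1) := by
    rw [← ip_pred hy0 hy1]; congr 1; ring
  have a2 : ip (Q ^ 2) ((N : ℤ) + (k - 1)) = (1 - (Q ^ 2) ^ ((N : ℤ) + k)) *
      ((1 - (Q ^ 2) ^ ((N : ℤ) + k + 1)) * ip (Q ^ 2) (N + k + 1)) := by
    rw [← a1, ← ip_pred hy0 hy1]; congr 1; ring
  have b1 : ip (Q ^ 2) ((N : ℤ) - k) = (1 - (Q ^ 2) ^ ((N : ℤ) - k + 1)) * ip (Q ^ 2) (N - k + 1) := by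
    rw [← ip_pred hy0 hy1]; congr 1; ring
  have b2 : ip (Q ^ 2) ((N : ℤ) - (k + 1)) = (1 - (Q ^ 2) ^ ((N : ℤ) - k)) *
      ((1 - (Q ^ 2) ^ ((N : ℤ) - k + 1)) * ip (Q ^ 2) (N - k + 1)) := by
    rw [← b1, ← ip_pred hy0 hy1]; congr 1; ring
  have c1 : (N : ℤ) + (k + 1) = N + k + 1 := by ring
  have c2 : (N : ℤ) - (k - 1) = N - k + 1 := by ring
  have c3 : ((N + 1 : ℕ) : ℤ) + k = N + k + 1 := by push_cast; ring
  have c4 : ((N + 1 : ℕ) : ℤ) - k = N - k + 1 := by push_cast; ring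
  rw [a1, a2, b1, b2, c1, c2, c3, c4, show 2 * (N + 1) = 2 * N + 1 + 1 by ring, P_succ, P_succ]
  generalize ip (Q ^ 2) ((N : ℤ) + k + 1) = X
  generalize ip (Q ^ 2) ((N : ℤ) - k + 1) = Y
  generalize P (Q ^ 2) (2 * N) = W
  have hQ2 : (Q ^ 2) ≠ 0 := hy0.ne'
  rw [show (k - 1) ^ 2 = k ^ 2 - 2 * k + 1 by ring, show (k + 1) ^ 2 = k ^ 2 + 2 * k + 1 by ring]
  simp only [zpow_add₀ hQ2, zpow_sub₀ hQ2, zpow_add₀ h0.ne', zpow_sub₀ h0.ne', zpow_mul, zpow_one,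
    zpow_natCast]
  rw [show (Q ^ (2 : ℤ)) ^ k = (Q ^ 2) ^ k from rfl]
  have hB : (Q ^ 2) ^ k ≠ 0 := zpow_ne_zero _ hQ2
  generalize (Q ^ 2) ^ k = B at *
  generalize Q ^ (k ^ 2) = C
  field_simp
  ring

lemma ip_nonneg {y : ℝ} (h0 : 0 < y) (h1 : y < 1) (j : ℤ) : 0 ≤ ip y j := by
  unfold ip; split_ifs
  · exact le_rfl
  · exact (inv_pos.2 (P_pos h0 h1 _)).le

lemma cc_eq_zero {Q : ℝ} (N : ℕ) (k : ℤ) (h : k ∉ Finset.Icc (-(N : ℤ)) N) : cc Q N k = 0 := by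
  rw [Finset.mem_Icc, not_and_or] at h
  unfold cc ip
  rcases h with h | h
  · rw [if_pos (by omega)]; simp
  · rw [if_pos (c := (N : ℤ) - k < 0) (by omega)]; simp

lemma cc_summable (Q : ℝ) (x : ℝ) (N : ℕ) (j : ℤ) :
    Summable fun k : ℤ => cc Q N (k + j) * x ^ k := by
  apply summable_of_hasFiniteSupport
  apply Set.Finite.subset (Finset.finite_toSet (Finset.Icc (-(N : ℤ) - j) (N - j)))
  intro k hk
  by_contra hh
  apply hk
  have : cc Q N (k + j) = 0 := by
    apply cc_eq_zero
    simp only [Finset.coe_Icc, Set.mem_Icc, Finset.mem_Icc] at hh ⊢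
    omega
  simp [this]

lemma finite_triple {Q x : ℝ} (h0 : 0 < Q) (h1 : Q < 1) (hx : x ≠ 0) (N : ℕ) :
    ∏ m ∈ Finset.range N, ((1 + x * Q ^ (2 * m + 1)) * (1 + x⁻¹ * Q ^ (2 * m + 1))) =
      ∑' k : ℤ, cc Q N k * x ^ k := by
  induction N with
  | zero =>
    rw [tsum_eq_single 0]
    · simp [cc, ip, P]
    · intro k hk
      rw [cc_eq_zero, zero_mul]
      simp; omega
  | succ N ih =>
    rw [Finset.prod_range_succ, ih]
    have e : ∀ k : ℤ, cc Q (N + 1) k * x ^ k = (1 + Q ^ (2 * (2 * N + 1))) * (cc Q N k * x ^ k) +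
      (Q ^ (2 * N + 1) * (cc Q N (k + (-1)) * x ^ k) + Q ^ (2 * N + 1) * (cc Q N (k + 1) * x ^ k)) := by
      intro k; rw [cc_succ h0 h1, ← sub_eq_add_neg]; ring
    have s0 := cc_summable Q x N 0
    simp only [add_zero] at s0
    have sm := cc_summable Q x N (-1)
    have sp := cc_summable Q x N 1
    rw [tsum_congr e, (s0.mul_left _).tsum_add ((sm.mul_left _).add (sp.mul_left _)),
      (sm.mul_left _).tsum_add (sp.mul_left _), tsum_mul_left, tsum_mul_left, tsum_mul_left]
    have e1 : ∑' k : ℤ, cc Q N (k + (-1)) * x ^ k = x * ∑' k : ℤ, cc Q N k * x ^ k := by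
      rw [← (Equiv.addRight (1 : ℤ)).tsum_eq, ← tsum_mul_left]
      apply tsum_congr; intro k
      simp [zpow_add₀ hx]; ring
    have e2 : ∑' k : ℤ, cc Q N (k + 1) * x ^ k = x⁻¹ * ∑' k : ℤ, cc Q N k * x ^ k := by
      rw [← (Equiv.addRight (-1 : ℤ)).tsum_eq, ← tsum_mul_left]
      apply tsum_congr; intro k
      simp [zpow_add₀ hx]; ring
    rw [e1, e2]
    field_simp
    ring

lemma multipliable_mul_pow {Q : ℝ} (h0 : 0 < Q) (h1 : Q < 1) (x : ℝ) (a b : ℕ) (ha : 0 < a) :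
    Multipliable fun m : ℕ => 1 + x * Q ^ (a * m + b) := by
  apply multipliable_one_add_of_summable
  have : Summable fun m : ℕ => |x| * Q ^ b * (Q ^ a) ^ m :=
    (summable_geometric_of_lt_one (by positivity) (pow_lt_one₀ h0.le h1 ha.ne')).mul_left _
  refine this.congr fun m => ?_
  rw [norm_mul, Real.norm_eq_abs, Real.norm_of_nonneg (by positivity)]
  rw [pow_add, pow_mul]; ring

/-- Euler product -/
noncomputable def E (y : ℝ) : ℝ := ∏' m : ℕ, (1 - y ^ (m + 1))

lemma multipliable_E {y : ℝ} (h0 : 0 < y) (h1 : y < 1) : Multipliable fun m : ℕ => 1 - y ^ (m + 1) := by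
  simpa [sub_eq_add_neg] using multipliable_mul_pow h0 h1 (-1) 1 1 one_pos

lemma P_tendsto {y : ℝ} (h0 : 0 < y) (h1 : y < 1) : Tendsto (P y) atTop (𝓝 (E y)) :=
  (multipliable_E h0 h1).hasProd.tendsto_prod_nat

lemma E_le_P {y : ℝ} (h0 : 0 < y) (h1 : y < 1) (n : ℕ) : E y ≤ P y n := by
  have hanti : Antitone (P y) := antitone_nat_of_succ_le fun n => by
    rw [P_succ]
    have := P_pos h0 h1 n
    have : 0 < y ^ (n + 1) := by positivity
    nlinarith
  exact hanti.le_of_tendsto (P_tendsto h0 h1) n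

lemma E_pos {y : ℝ} (h0 : 0 < y) (h1 : y < 1) : 0 < E y := by
  have h : 0 ≤ E y := ge_of_tendsto' (P_tendsto h0 h1) fun n => (P_pos h0 h1 n).le
  refine lt_of_le_of_ne h (Ne.symm ?_)
  have := tprod_one_add_ne_zero_of_summable (f := fun m : ℕ => -y ^ (m + 1)) ?_ ?_
  · simpa [E, sub_eq_add_neg] using this
  · intro i; have := one_sub_pow_pos h0 h1 i; rw [← sub_eq_add_neg]; exact this.ne'
  · simp only [norm_neg, norm_pow, Real.norm_of_nonneg h0.le]
    exact ((summable_geometric_of_lt_one h0.le h1).mul_left y).congr fun m => by ring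

lemma P_le_one {y : ℝ} (h0 : 0 < y) (h1 : y < 1) (n : ℕ) : P y n ≤ 1 :=
  Finset.prod_le_one (fun i _ => (one_sub_pow_pos h0 h1 i).le) fun i _ => by
    have : 0 < y ^ (i + 1) := by positivity
    linarith

lemma ip_le {y : ℝ} (h0 : 0 < y) (h1 : y < 1) (j : ℤ) : ip y j ≤ (E y)⁻¹ := by
  unfold ip; split_ifs
  · exact (inv_pos.2 (E_pos h0 h1)).le
  · exact inv_anti₀ (E_pos h0 h1) (E_le_P h0 h1 _)

lemma ip_tendsto {y : ℝ} (h0 : 0 < y) (h1 : y < 1) (k : ℤ) :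
    Tendsto (fun N : ℕ => ip y (N + k)) atTop (𝓝 (E y)⁻¹) := by
  have h2 : Tendsto (fun N : ℕ => ((N : ℤ) + k).toNat) atTop atTop := by
    apply tendsto_atTop.2
    intro b
    filter_upwards [eventually_ge_atTop (b + k.natAbs)] with N hN
    omega
  have h3 := ((P_tendsto h0 h1).comp h2).inv₀ (E_pos h0 h1).ne'
  refine h3.congr' ?_
  filter_upwards [eventually_ge_atTop k.natAbs] with N hN
  unfold ip
  rw [if_neg (by omega)]; rfl

theorem triple_product {Q x : ℝ} (h0 : 0 < Q) (h1 : Q < 1) (hx : Q ≤ |x|) (hx' : |x| ≤ Q⁻¹) :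
    ∑' k : ℤ, Q ^ (k ^ 2) * x ^ k = E (Q ^ 2) * ((∏' m : ℕ, (1 + x * Q ^ (2 * m + 1))) *
      ∏' m : ℕ, (1 + x⁻¹ * Q ^ (2 * m + 1))) := by
  have hy0 : 0 < Q ^ 2 := by positivity
  have hy1 : Q ^ 2 < 1 := by nlinarith
  have hE := E_pos hy0 hy1
  have hx0 : x ≠ 0 := by
    intro h; rw [h, abs_zero] at hx; linarith
  have m1 := multipliable_mul_pow h0 h1 x 2 1 two_pos
  have m2 := multipliable_mul_pow h0 h1 x⁻¹ 2 1 two_pos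
  have t1 := (m1.mul m2).hasProd.tendsto_prod_nat
  rw [m1.tprod_mul m2] at t1
  have t2 : Tendsto (fun N => ∑' k : ℤ, cc Q N k * x ^ k) atTop
      (𝓝 (∑' k : ℤ, (E (Q ^ 2))⁻¹ * (Q ^ (k ^ 2) * x ^ k))) := by
    apply tendsto_tsum_of_dominated_convergence
      (bound := fun k => (E (Q ^ 2))⁻¹ * (E (Q ^ 2))⁻¹ * (Q⁻¹ * Q ^ k.natAbs))
    · exact ((summable_int_geom h0 h1).mul_left _).mul_left _
    · intro k
      have tP : Tendsto (fun N : ℕ => P (Q ^ 2) (2 * N)) atTop (𝓝 (E (Q ^ 2))) :=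
        (P_tendsto hy0 hy1).comp (tendsto_id.const_mul_atTop' two_pos)
      have tt := (((tP.mul (ip_tendsto hy0 hy1 k)).mul (ip_tendsto hy0 hy1 (-k))).mul_const
        (Q ^ (k ^ 2))).mul_const (x ^ k)
      have e : (E (Q ^ 2))⁻¹ * (Q ^ (k ^ 2) * x ^ k) =
        E (Q ^ 2) * (E (Q ^ 2))⁻¹ * (E (Q ^ 2))⁻¹ * Q ^ (k ^ 2) * x ^ k := by
        field_simp
      rw [e]
      exact tt
    · refine Eventually.of_forall fun N k => ?_
      unfold cc
      have b1 := ip_le hy0 hy1 (N + k)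
      have b2 := ip_le hy0 hy1 (N - k)
      have b3 := ip_nonneg hy0 hy1 (N + k)
      have b4 := ip_nonneg hy0 hy1 (N - k)
      have b5 := P_le_one hy0 hy1 (2 * N)
      have b6 := P_pos hy0 hy1 (2 * N)
      have b7 := theta_term_le h0 h1 hx hx' k
      rw [mul_assoc, norm_mul, norm_mul (Q ^ (k ^ 2)), norm_zpow x, Real.norm_eq_abs x,
        Real.norm_of_nonneg (by positivity : 0 ≤ Q ^ (k ^ 2)), Real.norm_of_nonneg (by positivity)]
      have b8 : 0 ≤ Q ^ (k ^ 2) * |x| ^ k := by positivity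
      have hi : 0 ≤ (E (Q ^ 2))⁻¹ := by positivity
      apply mul_le_mul _ b7 b8 (by positivity)
      apply mul_le_mul _ b2 b4 hi
      calc P (Q ^ 2) (2 * N) * ip (Q ^ 2) (N + k) ≤ 1 * (E (Q ^ 2))⁻¹ :=
            mul_le_mul b5 b1 b3 zero_le_one
        _ = _ := one_mul _
  have t3 := tendsto_nhds_unique (t1.congr fun N => finite_triple h0 h1 hx0 N) t2
  rw [tsum_mul_left] at t3
  rw [t3]
  field_simp

end Rep10

namespace Rep10
open Filter Topology

lemma tsum_conv {𝕜 : Type*} [NormedField 𝕜] [CompleteSpace 𝕜] {f g : ℤ → 𝕜}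
    (hf : Summable fun n => ‖f n‖) (hg : Summable fun n => ‖g n‖) :
    HasSum (fun N => ∑' m, f m * g (N - m)) ((∑' n, f n) * ∑' n, g n) := by
  have hs : Summable fun z : ℤ × ℤ => f z.1 * g z.2 := summable_mul_of_summable_norm hf hg
  let e : ℤ × ℤ ≃ ℤ × ℤ :=
    { toFun := fun z => (z.2, z.1 - z.2)
      invFun := fun z => (z.1 + z.2, z.1)
      left_inv := fun z => by simp
      right_inv := fun z => by simp }
  have hs' : Summable fun z : ℤ × ℤ => f z.2 * g (z.1 - z.2) := (e.summable_iff.2 hs)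
  rw [tsum_mul_tsum_of_summable_norm hf hg, ← e.tsum_eq]
  have := hs'.hasSum.prod_fiberwise fun N => (hs'.prod_factor N).hasSum
  exact this

lemma hasSum_even_odd {𝕜 : Type*} [AddCommMonoid 𝕜] [TopologicalSpace 𝕜] [ContinuousAdd 𝕜]
    {f : ℤ → 𝕜} {a b : 𝕜}
    (ha : HasSum (fun k : ℤ => f (2 * k)) a) (hb : HasSum (fun k : ℤ => f (2 * k + 1)) b) :
    HasSum f (a + b) := by
  have hc : IsCompl (Set.range fun k : ℤ => 2 * k) (Set.range fun k : ℤ => 2 * k + 1) := by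
    constructor
    · rw [Set.disjoint_left]
      rintro x ⟨k, rfl⟩ ⟨l, hl⟩
      simp only at hl
      omega
    · rw [codisjoint_iff]
      ext x
      simp only [Set.sup_eq_union, Set.mem_union, Set.mem_range, Set.top_eq_univ, Set.mem_univ, iff_true]
      rcases Int.even_or_odd' x with ⟨k, h | h⟩
      · exact Or.inl ⟨k, h.symm⟩
      · exact Or.inr ⟨k, h.symm⟩
  refine HasSum.add_isCompl hc ?_ ?_
  · exact (Function.Injective.hasSum_range_iff (f := f) (g := fun k : ℤ => 2 * k)
      (fun x y h => by simpa using h)).2 ha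
  · exact (Function.Injective.hasSum_range_iff (f := f) (g := fun k : ℤ => 2 * k + 1)
      (fun x y h => by simpa using h)).2 hb

/-- theta constants -/
noncomputable def ph (q : ℝ) : ℝ := ∑' n : ℤ, q ^ (n ^ 2)
noncomputable def pm (q : ℝ) : ℝ := ∑' n : ℤ, q ^ (n ^ 2) * (-1) ^ n
noncomputable def be (q : ℝ) : ℝ := ∑' k : ℤ, q ^ ((2 * k + 1) ^ 2)
noncomputable def ps (q : ℝ) : ℝ := ∑' k : ℤ, q ^ (2 * k ^ 2 + k)
noncomputable def pms (q : ℝ) : ℝ := ∑' k : ℤ, q ^ (2 * k ^ 2 + k) * (-1) ^ k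
noncomputable def Op (q : ℝ) : ℝ := ∏' m : ℕ, (1 + q ^ (2 * m + 1))
noncomputable def Om (q : ℝ) : ℝ := ∏' m : ℕ, (1 - q ^ (2 * m + 1))

lemma pow_pos_lt {q : ℝ} (h0 : 0 < q) (h1 : q < 1) (n : ℕ) (hn : n ≠ 0) : 0 < q ^ n ∧ q ^ n < 1 :=
  ⟨by positivity, pow_lt_one₀ h0.le h1 hn⟩

lemma summable_ph {q : ℝ} (h0 : 0 < q) (h1 : q < 1) : Summable fun n : ℤ => q ^ (n ^ 2) := by
  refine Summable.of_nonneg_of_le (fun _ => by positivity) (fun n => ?_)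
    ((summable_int_geom h0 h1).mul_left q⁻¹)
  have := theta_term_le h0 h1 h1.le ((one_le_inv₀ h0).2 h1.le) n
  simpa using this

lemma ph_prod {q : ℝ} (h0 : 0 < q) (h1 : q < 1) : ph q = E (q ^ 2) * Op q ^ 2 := by
  have := triple_product h0 h1 (x := 1) (by simpa using h1.le) (by simpa using (one_le_inv₀ h0).2 h1.le)
  simp only [one_zpow, mul_one, one_mul, inv_one] at this
  rw [ph, this, Op]; ring

lemma pm_prod {q : ℝ} (h0 : 0 < q) (h1 : q < 1) : pm q = E (q ^ 2) * Om q ^ 2 := by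
  have := triple_product h0 h1 (x := -1) (by simpa using h1.le) (by simpa using (one_le_inv₀ h0).2 h1.le)
  simp only [inv_neg, inv_one, neg_mul, one_mul, ← sub_eq_add_neg] at this
  rw [pm, this, Om]; ring

lemma mult_Op {q : ℝ} (h0 : 0 < q) (h1 : q < 1) : Multipliable fun m : ℕ => 1 + q ^ (2 * m + 1) := by
  simpa using multipliable_mul_pow h0 h1 1 2 1 two_pos

lemma mult_Om {q : ℝ} (h0 : 0 < q) (h1 : q < 1) : Multipliable fun m : ℕ => 1 - q ^ (2 * m + 1) := by
  simpa [sub_eq_add_neg] using multipliable_mul_pow h0 h1 (-1) 2 1 two_pos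

lemma E_eq_Om {q : ℝ} (h0 : 0 < q) (h1 : q < 1) : E q = Om q * E (q ^ 2) := by
  have e := tprod_even_mul_odd (f := fun m : ℕ => 1 - q ^ (m + 1)) (mult_Om h0 h1) (by
    have := multipliable_E (pow_pos_lt h0 h1 2 two_ne_zero).1 (pow_pos_lt h0 h1 2 two_ne_zero).2
    refine this.congr fun m => ?_
    rw [← pow_mul]; ring_nf)
  rw [E, ← e, Om, E]
  congr 1
  apply tprod_congr; intro m
  rw [← pow_mul]; ring_nf

lemma Op_mul_Om {q : ℝ} (h0 : 0 < q) (h1 : q < 1) : Op q * Om q = Om (q ^ 2) := by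
  rw [Op, Om, ← (mult_Op h0 h1).tprod_mul (mult_Om h0 h1), Om]
  apply tprod_congr; intro m
  rw [← pow_mul]; ring

lemma Om_eq {q : ℝ} (h0 : 0 < q) (h1 : q < 1) : Om q = E q / E (q ^ 2) := by
  have := E_pos (pow_pos_lt h0 h1 2 two_ne_zero).1 (pow_pos_lt h0 h1 2 two_ne_zero).2
  rw [E_eq_Om h0 h1]; field_simp

lemma Op_eq {q : ℝ} (h0 : 0 < q) (h1 : q < 1) : Op q = E (q ^ 2) ^ 2 / (E q * E (q ^ 4)) := by
  have p2 := pow_pos_lt h0 h1 2 two_ne_zero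
  have p4 := pow_pos_lt h0 h1 4 (by norm_num)
  have := E_pos h0 h1
  have := E_pos p2.1 p2.2
  have := E_pos p4.1 p4.2
  have h := Op_mul_Om h0 h1
  rw [Om_eq h0 h1, Om_eq p2.1 p2.2, ← pow_mul] at h
  norm_num at h
  field_simp at h ⊢
  linarith

lemma ph_eq {q : ℝ} (h0 : 0 < q) (h1 : q < 1) : ph q = E (q ^ 2) ^ 5 / (E q ^ 2 * E (q ^ 4) ^ 2) := by
  rw [ph_prod h0 h1, Op_eq h0 h1]; ring

lemma pm_eq {q : ℝ} (h0 : 0 < q) (h1 : q < 1) : pm q = E q ^ 2 / E (q ^ 2) := by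
  have p2 := pow_pos_lt h0 h1 2 two_ne_zero
  have := E_pos p2.1 p2.2
  rw [pm_prod h0 h1, Om_eq h0 h1]; field_simp

lemma ps_eq {q : ℝ} (h0 : 0 < q) (h1 : q < 1) : ps q = E (q ^ 4) * Op q := by
  have p2 := pow_pos_lt h0 h1 2 two_ne_zero
  have := triple_product p2.1 p2.2 (x := q) (by rw [abs_of_pos h0]; nlinarith)
    (by rw [abs_of_pos h0]; exact h1.le.trans ((one_le_inv₀ p2.1).2 p2.2.le))
  have e : ps q = ∑' k : ℤ, (q ^ 2) ^ (k ^ 2) * q ^ k := by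
    apply tsum_congr; intro k
    rw [zpow_add₀ h0.ne', zpow_mul]; rfl
  rw [e, this, ← pow_mul]
  congr 1
  rw [Op, ← tprod_even_mul_odd (f := fun m : ℕ => 1 + q ^ (2 * m + 1)), mul_comm]
  · congr 1
    · apply tprod_congr; intro m
      rw [← pow_mul]; field_simp; ring
    · apply tprod_congr; intro m
      rw [← pow_mul]; ring
  · simpa [← mul_assoc] using multipliable_mul_pow h0 h1 1 4 1 (by norm_num)
  · refine (multipliable_mul_pow h0 h1 1 4 3 (by norm_num)).congr fun m => ?_
    ring

lemma pms_eq {q : ℝ} (h0 : 0 < q) (h1 : q < 1) : pms q = E (q ^ 4) * Om q := by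
  have p2 := pow_pos_lt h0 h1 2 two_ne_zero
  have := triple_product p2.1 p2.2 (x := -q) (by rw [abs_neg, abs_of_pos h0]; nlinarith)
    (by rw [abs_neg, abs_of_pos h0]; exact h1.le.trans ((one_le_inv₀ p2.1).2 p2.2.le))
  have e : pms q = ∑' k : ℤ, (q ^ 2) ^ (k ^ 2) * (-q) ^ k := by
    apply tsum_congr; intro k
    rw [zpow_add₀ h0.ne', zpow_mul, neg_eq_neg_one_mul q, mul_zpow]
    rw [show q ^ (2 : ℤ) = q ^ 2 from rfl]; ring
  rw [e, this, ← pow_mul]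
  congr 1
  rw [Om, ← tprod_even_mul_odd (f := fun m : ℕ => 1 - q ^ (2 * m + 1)), mul_comm]
  · congr 1
    · apply tprod_congr; intro m
      rw [← pow_mul]; field_simp; ring
    · apply tprod_congr; intro m
      rw [← pow_mul]; ring
  · refine (multipliable_mul_pow h0 h1 (-1) 4 1 (by norm_num)).congr fun m => ?_
    ring
  · refine (multipliable_mul_pow h0 h1 (-1) 4 3 (by norm_num)).congr fun m => ?_
    ring

lemma ps_rel {q : ℝ} (h0 : 0 < q) (h1 : q < 1) : ps q * pm (q ^ 2) = ph q * pms q := by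
  have p2 := pow_pos_lt h0 h1 2 two_ne_zero
  have p4 := pow_pos_lt h0 h1 4 (by norm_num)
  have := E_pos h0 h1
  have := E_pos p2.1 p2.2
  have := E_pos p4.1 p4.2
  rw [ps_eq h0 h1, pms_eq h0 h1, ph_eq h0 h1, pm_eq p2.1 p2.2, Om_eq h0 h1, Op_eq h0 h1, ← pow_mul]
  norm_num
  field_simp

lemma prod_one_add {q : ℝ} (h0 : 0 < q) (h1 : q < 1) : (∏' m : ℕ, (1 + q ^ (m + 1))) = E (q ^ 2) / E q := by
  have := E_pos h0 h1
  rw [eq_div_iff this.ne', E, E, ← Multipliable.tprod_mul _ (multipliable_E h0 h1)]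
  · apply tprod_congr; intro m
    rw [← pow_mul]; ring
  · simpa using multipliable_mul_pow h0 h1 1 1 1 one_pos

lemma be_eq {q : ℝ} (h0 : 0 < q) (h1 : q < 1) : be q = 2 * q * (E (q ^ 16) ^ 2 / E (q ^ 8)) := by
  have p4 := pow_pos_lt h0 h1 4 (by norm_num)
  have p8 := pow_pos_lt h0 h1 8 (by norm_num)
  have := E_pos p8.1 p8.2
  have ht := triple_product p4.1 p4.2 (x := q ^ 4) (by rw [abs_of_pos p4.1])
    (by rw [abs_of_pos p4.1]; exact p4.2.le.trans ((one_le_inv₀ p4.1).2 p4.2.le))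
  have e : be q = q * ∑' k : ℤ, (q ^ 4) ^ (k ^ 2) * (q ^ 4) ^ k := by
    rw [be, ← tsum_mul_left]
    apply tsum_congr; intro k
    rw [show (2 * k + 1) ^ 2 = 1 + (4 * k ^ 2 + 4 * k) by ring, zpow_add₀ h0.ne', zpow_add₀ h0.ne',
      zpow_mul, zpow_mul, zpow_one]
    rfl
  have m8 : Multipliable fun m : ℕ => 1 + (q ^ 8) ^ (m + 1) := by
    simpa using multipliable_mul_pow p8.1 p8.2 1 1 1 one_pos
  have e2 : ∏' m : ℕ, (1 + (q ^ 4)⁻¹ * (q ^ 4) ^ (2 * m + 1)) = 2 * ∏' m : ℕ, (1 + (q ^ 8) ^ (m + 1)) := by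
    have e3 : ∀ m : ℕ, 1 + (q ^ 4)⁻¹ * (q ^ 4) ^ (2 * m + 1) = 1 + (q ^ 8) ^ m := by
      intro m; rw [← pow_mul, ← pow_mul]; field_simp; ring
    rw [tprod_congr e3, tprod_eq_zero_mul']
    · norm_num
    · exact m8
  have e4 : ∏' m : ℕ, (1 + q ^ 4 * (q ^ 4) ^ (2 * m + 1)) = ∏' m : ℕ, (1 + (q ^ 8) ^ (m + 1)) := by
    apply tprod_congr; intro m
    rw [← pow_mul, ← pow_mul]; ring
  rw [e, ht, e2, e4, prod_one_add p8.1 p8.2, ← pow_mul, ← pow_mul]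
  norm_num
  field_simp

lemma ph4 (q : ℝ) (k : ℤ) : q ^ ((2 * k) ^ 2) = (q ^ 4) ^ (k ^ 2) := by
  rw [show (2 * k) ^ 2 = 4 * k ^ 2 by ring, zpow_mul]; rfl

lemma summable_be {q : ℝ} (h0 : 0 < q) (h1 : q < 1) : Summable fun k : ℤ => q ^ ((2 * k + 1) ^ 2) :=
  (summable_ph h0 h1).comp_injective (i := fun k : ℤ => 2 * k + 1) (fun x y h => by simpa using h)

lemma hasSum_evens {q : ℝ} (h0 : 0 < q) (h1 : q < 1) : HasSum (fun k : ℤ => q ^ ((2 * k) ^ 2)) (ph (q ^ 4)) := by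
  have p4 := pow_pos_lt h0 h1 4 (by norm_num)
  simp only [ph4 q]
  exact (summable_ph p4.1 p4.2).hasSum

lemma ph_split {q : ℝ} (h0 : 0 < q) (h1 : q < 1) : ph q = ph (q ^ 4) + be q :=
  (hasSum_even_odd (f := fun n : ℤ => q ^ (n ^ 2)) (hasSum_evens h0 h1)
    (summable_be h0 h1).hasSum).tsum_eq

lemma pm_split {q : ℝ} (h0 : 0 < q) (h1 : q < 1) : pm q = ph (q ^ 4) - be q := by
  rw [sub_eq_add_neg]
  refine (hasSum_even_odd (f := fun n : ℤ => q ^ (n ^ 2) * (-1) ^ n) ?_ ?_).tsum_eq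
  · simpa [zpow_mul] using hasSum_evens h0 h1
  · have := (summable_be h0 h1).hasSum.neg
    refine (this.congr_fun ?_)
    intro k
    rw [zpow_add₀ (by norm_num), zpow_mul]; simp

lemma pm_sq {q : ℝ} (h0 : 0 < q) (h1 : q < 1) : pm (q ^ 2) ^ 2 = ph q * pm q := by
  have p2 := pow_pos_lt h0 h1 2 two_ne_zero
  have p4 := pow_pos_lt h0 h1 4 (by norm_num)
  have := E_pos h0 h1
  have := E_pos p2.1 p2.2
  have := E_pos p4.1 p4.2
  rw [ph_eq h0 h1, pm_eq p2.1 p2.2, pm_eq h0 h1, ← pow_mul]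
  norm_num
  field_simp

lemma ph_sq {q : ℝ} (h0 : 0 < q) (h1 : q < 1) : ph (q ^ 2) ^ 2 = ph (q ^ 4) ^ 2 + be q ^ 2 := by
  have p2 := pow_pos_lt h0 h1 2 two_ne_zero
  have hs := (summable_ph p2.1 p2.2).norm
  have h := tsum_conv hs hs
  have key : ∀ N : ℤ, ∑' m : ℤ, (q ^ 2) ^ (m ^ 2) * (q ^ 2) ^ ((N - m) ^ 2) =
      q ^ (N ^ 2) * ∑' m : ℤ, q ^ ((2 * m - N) ^ 2) := by
    intro N
    rw [← tsum_mul_left]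
    apply tsum_congr; intro m
    rw [show q ^ 2 = q ^ (2 : ℤ) from rfl, ← zpow_mul, ← zpow_mul, ← zpow_add₀ h0.ne',
      ← zpow_add₀ h0.ne']
    congr 1; ring
  simp only [key] at h
  have h2 : HasSum (fun N : ℤ => q ^ (N ^ 2) * ∑' m : ℤ, q ^ ((2 * m - N) ^ 2))
      (ph (q ^ 4) * ph (q ^ 4) + be q * be q) := by
    refine hasSum_even_odd ?_ ?_
    · refine ((hasSum_evens h0 h1).mul_right (ph (q ^ 4))).congr_fun fun k => ?_
      congr 1
      rw [← (hasSum_evens h0 h1).tsum_eq, ← (Equiv.addRight k).tsum_eq]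
      apply tsum_congr; intro m
      congr 1; simp; ring
    · refine ((summable_be h0 h1).hasSum.mul_right (be q)).congr_fun fun k => ?_
      congr 1
      rw [be, ← (Equiv.addRight (k + 1)).tsum_eq]
      apply tsum_congr; intro m
      congr 1; simp; ring
  have := h.unique h2
  rw [pow_two (ph (q ^ 2)), pow_two (ph (q ^ 4)), pow_two (be q), ← this]; rfl

lemma ph_pos {q : ℝ} (h0 : 0 < q) (h1 : q < 1) : 0 < ph q := by
  have p2 := pow_pos_lt h0 h1 2 two_ne_zero
  have p4 := pow_pos_lt h0 h1 4 (by norm_num)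
  have := E_pos h0 h1
  have := E_pos p2.1 p2.2
  have := E_pos p4.1 p4.2
  rw [ph_eq h0 h1]; positivity

lemma pm_pos {q : ℝ} (h0 : 0 < q) (h1 : q < 1) : 0 < pm q := by
  have p2 := pow_pos_lt h0 h1 2 two_ne_zero
  have := E_pos h0 h1
  have := E_pos p2.1 p2.2
  rw [pm_eq h0 h1]; positivity

lemma pms_pos {q : ℝ} (h0 : 0 < q) (h1 : q < 1) : 0 < pms q := by
  have p2 := pow_pos_lt h0 h1 2 two_ne_zero
  have p4 := pow_pos_lt h0 h1 4 (by norm_num)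
  have := E_pos h0 h1
  have := E_pos p2.1 p2.2
  have := E_pos p4.1 p4.2
  rw [pms_eq h0 h1, Om_eq h0 h1]; positivity

lemma be_pos {q : ℝ} (h0 : 0 < q) (h1 : q < 1) : 0 < be q := by
  have p8 := pow_pos_lt h0 h1 8 (by norm_num)
  have p16 := pow_pos_lt h0 h1 16 (by norm_num)
  have := E_pos p8.1 p8.2
  have := E_pos p16.1 p16.2
  rw [be_eq h0 h1]; positivity


end Rep10

namespace Rep10
open Filter Topology

lemma hasSum_of_eq {ι 𝕜 : Type*} [AddCommMonoid 𝕜] [TopologicalSpace 𝕜] {f g : ι → 𝕜} {a b : 𝕜}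
    (h : HasSum f a) (hf : ∀ k, g k = f k) (hab : b = a) : HasSum g b := by
  rw [hab, show g = f from funext hf]; exact h

/-! ### Class sums of sign-like odd functions -/

lemma sgn_step (c : ℤ) : HasSum (fun k : ℤ => ((Int.sign (2 * k + (c + 1)) : ℝ) - (Int.sign (2 * k + c) : ℝ))) 1 := by
  have h := hasSum_single (f := fun k : ℤ => ((Int.sign (2 * k + (c + 1)) : ℝ) - (Int.sign (2 * k + c) : ℝ)))
    (-((c + 1) / 2)) (by
      intro k hk
      have : 2 * k + c ≠ 0 ∧ 2 * k + c ≠ -1 := by omega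
      rcases lt_or_gt_of_ne this.1 with h | h
      · rw [Int.sign_eq_neg_one_of_neg (by omega), Int.sign_eq_neg_one_of_neg (by omega)]; simp
      · rw [Int.sign_eq_one_of_pos (by omega), Int.sign_eq_one_of_pos (by omega)]; simp)
  convert h using 1
  have : 2 * (-((c + 1) / 2)) + c = 0 ∨ 2 * (-((c + 1) / 2)) + c = -1 := by omega
  rcases this with h | h
  · have h' : 2 * (-((c + 1) / 2)) + (c + 1) = 1 := by omega
    simp only [h, h']; simp
  · have h' : 2 * (-((c + 1) / 2)) + (c + 1) = 0 := by omega
    simp only [h, h']; simp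

lemma sgn_sum (c : ℤ) : HasSum (fun k : ℤ => ((Int.sign (2 * k + c) : ℝ) - (Int.sign (2 * k) : ℝ))) c := by
  induction c using Int.induction_on with
  | zero => simp [hasSum_zero]
  | succ i ih =>
    have := ih.add (sgn_step i)
    exact hasSum_of_eq this (fun k => by ring) (by push_cast; ring)
  | pred i ih =>
    have := ih.sub (sgn_step (-i - 1))
    exact hasSum_of_eq this (fun k => by rw [show (-(i:ℤ) - 1 + 1) = -i by ring]; ring) (by push_cast; ring)

lemma odd_class_sum {g : ℤ → ℝ} (ho : ∀ n, g (-n) = - g n)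
    (hs : Summable fun n : ℤ => g n - (Int.sign n : ℝ)) (c : ℤ) :
    HasSum (fun k : ℤ => g (2 * k + c) - (Int.sign (2 * k + c) : ℝ)) 0 := by
  have hs' : Summable (fun k : ℤ => g (2 * k + c) - (Int.sign (2 * k + c) : ℝ)) :=
    hs.comp_injective (i := fun k : ℤ => 2 * k + c) (fun x y h => by simpa using h)
  have h := hs'.hasSum
  have h2 := ((Equiv.subLeft (-c)).hasSum_iff.2 h).neg
  have e : (fun k : ℤ => - ((fun k : ℤ => g (2 * k + c) - (Int.sign (2 * k + c) : ℝ)) ∘ (Equiv.subLeft (-c))) k)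
      = (fun k : ℤ => g (2 * k + c) - (Int.sign (2 * k + c) : ℝ)) := by
    ext k
    simp only [Function.comp, Equiv.subLeft_apply]
    rw [show 2 * (-c - k) + c = -(2 * k + c) by ring, ho, Int.sign_neg]
    push_cast; ring
  rw [e] at h2
  have := h.unique h2
  have h0 : (∑' k : ℤ, (g (2 * k + c) - (Int.sign (2 * k + c) : ℝ))) = 0 := by linarith
  rwa [h0] at h

lemma class_sum {g1 g2 : ℤ → ℝ} (ho1 : ∀ n, g1 (-n) = - g1 n) (ho2 : ∀ n, g2 (-n) = - g2 n)
    (hs1 : Summable fun n : ℤ => g1 n - (Int.sign n : ℝ))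
    (hs2 : Summable fun n : ℤ => g2 n - (Int.sign n : ℝ)) (p c : ℤ) :
    HasSum (fun k : ℤ => g1 (2 * k + p) - g2 (2 * k + c)) ((p - c : ℤ) : ℝ) := by
  have := ((odd_class_sum ho1 hs1 p).sub (odd_class_sum ho2 hs2 c)).add ((sgn_sum p).sub (sgn_sum c))
  exact hasSum_of_eq this (fun k => by ring) (by push_cast; ring)

/-! ### The sequences -/

noncomputable def ee (q : ℝ) (n : ℤ) : ℝ := (q ^ n + q ^ (-n))⁻¹
noncomputable def hh (q : ℝ) (n : ℤ) : ℝ := (q ^ n - q ^ (-n))⁻¹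
noncomputable def sS (q : ℝ) (n : ℤ) : ℝ := if Even n then ee q n else 0
noncomputable def sU (q : ℝ) (n : ℤ) : ℝ := if Even n then 0 else ee q n
noncomputable def sV (q : ℝ) (n : ℤ) : ℝ := if Even n then 0 else hh q n
noncomputable def TT (q : ℝ) (n : ℤ) : ℝ := (q ^ (-n) - q ^ n) / (q ^ (-n) + q ^ n)
noncomputable def KK (q : ℝ) (n : ℤ) : ℝ := (q ^ (-n) + q ^ n) / (q ^ (-n) - q ^ n)

lemma TT_odd (q : ℝ) (n : ℤ) : TT q (-n) = - TT q n := by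
  rw [TT, TT, neg_neg, ← neg_div, neg_sub, add_comm]

lemma KK_odd (q : ℝ) (n : ℤ) : KK q (-n) = - KK q n := by
  rw [KK, KK, neg_neg, ← div_neg, neg_sub, add_comm]

lemma ee_even (q : ℝ) (n : ℤ) : ee q (-n) = ee q n := by
  rw [ee, ee, neg_neg, add_comm]

lemma hh_odd (q : ℝ) (n : ℤ) : hh q (-n) = - hh q n := by
  rw [hh, hh, neg_neg, ← inv_neg, neg_sub]

lemma zpow_sub_ne {q : ℝ} (h0 : 0 < q) (h1 : q < 1) {n : ℤ} (hn : n ≠ 0) : q ^ n - q ^ (-n) ≠ 0 := by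
  intro h
  have := zpow_right_injective₀ h0 h1.ne (sub_eq_zero.1 h)
  omega

lemma ee_nonneg {q : ℝ} (h0 : 0 < q) (n : ℤ) : 0 ≤ ee q n := by unfold ee; positivity

lemma ee_nat_le {q : ℝ} (h0 : 0 < q) (n : ℕ) : ee q n ≤ q ^ n := by
  rw [ee]
  have : 0 < q ^ n := by positivity
  rw [zpow_neg, zpow_natCast]
  rw [show q ^ n = ((q ^ n)⁻¹)⁻¹ by simp]
  apply inv_anti₀ (by positivity)
  simp; exact this.le

lemma ee_bound {q : ℝ} (h0 : 0 < q) (n : ℤ) : |ee q n| ≤ q ^ n.natAbs := by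
  rw [abs_of_nonneg (ee_nonneg h0 n)]
  rcases Int.natAbs_eq n with h | h
  · conv_lhs => rw [h]
    exact ee_nat_le h0 _
  · conv_lhs => rw [h, ee_even]
    exact ee_nat_le h0 _

lemma hh_nat_le {q : ℝ} (h0 : 0 < q) (h1 : q < 1) (n : ℕ) : |hh q n| ≤ (1 - q)⁻¹ * q ^ n := by
  rcases Nat.eq_zero_or_pos n with rfl | hn
  · simp [hh]; exact h1.le
  rw [hh]
  have hq : 0 < q ^ n := by positivity
  have hq1 : q ^ n ≤ q := by simpa using pow_le_pow_of_le_one h0.le h1.le (show 1 ≤ n from hn)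
  rw [zpow_neg, zpow_natCast, abs_inv, ← mul_inv_le_iff₀ hq, ← mul_inv]
  apply inv_anti₀ (by linarith)
  rw [abs_sub_comm]
  refine le_trans ?_ (mul_le_mul_of_nonneg_right (le_abs_self _) hq.le)
  rw [sub_mul, inv_mul_cancel₀ hq.ne']
  nlinarith

lemma hh_bound {q : ℝ} (h0 : 0 < q) (h1 : q < 1) (n : ℤ) : |hh q n| ≤ (1 - q)⁻¹ * q ^ n.natAbs := by
  rcases Int.natAbs_eq n with h | h
  · conv_lhs => rw [h]
    exact hh_nat_le h0 h1 _
  · conv_lhs => rw [h, hh_odd, abs_neg]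
    exact hh_nat_le h0 h1 _

lemma TT_sub {q : ℝ} (h0 : 0 < q) {n : ℕ} (_hn : 0 < n) : TT q n - 1 = -2 * q ^ n * ee q n := by
  rw [TT, ee]
  have : q ^ (n:ℤ) > 0 := by positivity
  have : q ^ (-n:ℤ) > 0 := by positivity
  rw [← zpow_natCast]
  field_simp
  ring

lemma KK_sub {q : ℝ} (h0 : 0 < q) (h1 : q < 1) {n : ℕ} (hn : 0 < n) : KK q n - 1 = -2 * q ^ n * hh q n := by
  rw [KK, hh]
  have h := zpow_sub_ne h0 h1 (n := n) (by omega)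
  have h' : q ^ (-n:ℤ) - q ^ (n:ℤ) ≠ 0 := fun hx => h (by linarith)
  rw [← zpow_natCast]
  field_simp
  ring

lemma sum_sgn_of {q : ℝ} (h0 : 0 < q) (h1 : q < 1) {g : ℤ → ℝ} (ho : ∀ n, g (-n) = - g n) (C : ℝ)
    (hC : ∀ n : ℕ, 0 < n → |g n - 1| ≤ C * q ^ n) : Summable fun n : ℤ => g n - (Int.sign n : ℝ) := by
  have g0 : g 0 = 0 := by have := ho 0; simp at this; linarith
  have hCn : 0 ≤ C := by
    have := (abs_nonneg _).trans (hC 1 one_pos)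
    simp at this
    nlinarith
  refine Summable.of_norm_bounded (g := fun n : ℤ => C * q ^ n.natAbs) ((summable_int_geom h0 h1).mul_left C) fun n => ?_
  rw [Real.norm_eq_abs]
  rcases lt_trichotomy n 0 with h | h | h
  · obtain ⟨m, hm⟩ := Int.eq_ofNat_of_zero_le (show 0 ≤ -n by omega)
    have hn : n = -(m:ℤ) := by omega
    subst hn
    have hm0 : 0 < m := by omega
    rw [ho, Int.sign_neg, Int.sign_natCast_of_ne_zero hm0.ne', Int.natAbs_neg, Int.natAbs_natCast]
    have := hC m hm0
    rw [← abs_neg] at this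
    convert this using 2
    push_cast; ring
  · subst h; simp [g0]; exact hCn
  · obtain ⟨m, hm⟩ := Int.eq_ofNat_of_zero_le h.le
    subst hm
    have hm0 : 0 < m := by omega
    rw [Int.sign_natCast_of_ne_zero hm0.ne', Int.natAbs_natCast]
    simpa using hC m hm0

lemma TT_summable {q : ℝ} (h0 : 0 < q) (h1 : q < 1) : Summable fun n : ℤ => TT q n - (Int.sign n : ℝ) := by
  refine sum_sgn_of h0 h1 (TT_odd q) 2 fun n hn => ?_
  rw [TT_sub h0 hn, abs_mul, abs_mul, abs_of_pos (pow_pos h0 n)]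
  have h2 := ee_bound h0 n
  rw [Int.natAbs_natCast] at h2
  have := pow_le_one₀ (n := n) h0.le h1.le
  have := pow_pos h0 n
  have : |(-2:ℝ)| = 2 := by norm_num
  rw [this]
  have := abs_nonneg (ee q n)
  nlinarith

lemma KK_summable {q : ℝ} (h0 : 0 < q) (h1 : q < 1) : Summable fun n : ℤ => KK q n - (Int.sign n : ℝ) := by
  refine sum_sgn_of h0 h1 (KK_odd q) (2 * (1 - q)⁻¹) fun n hn => ?_
  rw [KK_sub h0 h1 hn, abs_mul, abs_mul, abs_of_pos (pow_pos h0 n)]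
  have h2 := hh_bound h0 h1 n
  rw [Int.natAbs_natCast] at h2
  have := pow_le_one₀ (n := n) h0.le h1.le
  have := pow_pos h0 n
  have : |(-2:ℝ)| = 2 := by norm_num
  rw [this]
  have := abs_nonneg (hh q n)
  nlinarith

lemma eh_id {q : ℝ} (h0 : 0 < q) (h1 : q < 1) (a : ℤ) {b : ℤ} (hb : b ≠ 0) :
    ee q a * hh q b = -(1/2) * ee q (a + b) * (TT q a - KK q (-b)) := by
  have hb' := zpow_sub_ne h0 h1 hb
  rw [KK_odd, ee, ee, hh, TT, KK, neg_add, zpow_add₀ h0.ne', zpow_add₀ h0.ne', zpow_neg, zpow_neg] at *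
  set x := q ^ a
  set y := q ^ b
  have hx : 0 < x := by positivity
  have hy : 0 < y := by positivity
  have hy' : y ^ 2 - 1 ≠ 0 := fun h => hb' (by field_simp; linarith)
  have hy'' : 1 - y ^ 2 ≠ 0 := fun h => hy' (by linarith)
  have e1 : (x + x⁻¹)⁻¹ = x / (x ^ 2 + 1) := by field_simp
  have e2 : (y - y⁻¹)⁻¹ = y / (y ^ 2 - 1) := by
    rw [inv_eq_iff_eq_inv, inv_div]; field_simp
  have e3 : (x * y + x⁻¹ * y⁻¹)⁻¹ = x * y / (x ^ 2 * y ^ 2 + 1) := by field_simp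
  have e4 : (x⁻¹ - x) / (x⁻¹ + x) = (1 - x ^ 2) / (1 + x ^ 2) := by field_simp
  have e5 : (y⁻¹ + y) / (y⁻¹ - y) = - ((1 + y ^ 2) / (y ^ 2 - 1)) := by
    rw [show y⁻¹ - y = -(y ^ 2 - 1) / y by field_simp; ring, show y⁻¹ + y = (1 + y ^ 2) / y by field_simp]
    rw [neg_div, div_neg, div_div_div_cancel_right₀ hy.ne']
  rw [e1, e2, e3, e4, e5]
  field_simp
  ring

lemma ee_id {q : ℝ} (h0 : 0 < q) (h1 : q < 1) (a : ℤ) {b : ℤ} (hb : a + b ≠ 0) :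
    ee q a * ee q b = -(1/2) * hh q (a + b) * (TT q a - TT q (-b)) := by
  have hb' := zpow_sub_ne h0 h1 hb
  rw [TT_odd, ee, ee, hh, TT, TT]
  rw [neg_add, zpow_add₀ h0.ne', zpow_add₀ h0.ne', zpow_neg, zpow_neg] at *
  set x := q ^ a
  set y := q ^ b
  have hx : 0 < x := by positivity
  have hy : 0 < y := by positivity
  have hy' : x ^ 2 * y ^ 2 - 1 ≠ 0 := fun h => hb' (by field_simp; linarith)
  have e1 : (x + x⁻¹)⁻¹ = x / (x ^ 2 + 1) := by field_simp
  have e2 : (y + y⁻¹)⁻¹ = y / (y ^ 2 + 1) := by field_simp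
  have e3 : (x * y - x⁻¹ * y⁻¹)⁻¹ = x * y / (x ^ 2 * y ^ 2 - 1) := by
    rw [inv_eq_iff_eq_inv, inv_div]; field_simp
  have e4 : (x⁻¹ - x) / (x⁻¹ + x) = (1 - x ^ 2) / (1 + x ^ 2) := by field_simp
  have e5 : (y⁻¹ - y) / (y⁻¹ + y) = (1 - y ^ 2) / (1 + y ^ 2) := by field_simp
  rw [e1, e2, e3, e4, e5]
  field_simp
  ring

lemma hh_id {q : ℝ} (h0 : 0 < q) (h1 : q < 1) {a b : ℤ} (ha : a ≠ 0) (hb0 : b ≠ 0) (hb : a + b ≠ 0) :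
    hh q a * hh q b = -(1/2) * hh q (a + b) * (KK q a - KK q (-b)) := by
  have hb' := zpow_sub_ne h0 h1 hb
  have hb1 := zpow_sub_ne h0 h1 ha
  have hb2 := zpow_sub_ne h0 h1 hb0
  rw [KK_odd, hh, hh, hh, KK, KK]
  rw [neg_add, zpow_add₀ h0.ne', zpow_add₀ h0.ne'] at *
  rw [zpow_neg] at *
  rw [zpow_neg] at *
  set x := q ^ a
  set y := q ^ b
  have hx : 0 < x := by positivity
  have hy : 0 < y := by positivity
  have hy' : x ^ 2 * y ^ 2 - 1 ≠ 0 := fun h => hb' (by field_simp; linarith)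
  have hx1 : x ^ 2 - 1 ≠ 0 := fun h => hb1 (by field_simp; linarith)
  have hy1 : y ^ 2 - 1 ≠ 0 := fun h => hb2 (by field_simp; linarith)
  have k1 : ∀ y : ℝ, 0 < y → (y - y⁻¹)⁻¹ = y / (y ^ 2 - 1) := by
    intro y hy
    rw [inv_eq_iff_eq_inv, inv_div]; field_simp
  have e3 : (x * y - x⁻¹ * y⁻¹)⁻¹ = x * y / (x ^ 2 * y ^ 2 - 1) := by
    rw [inv_eq_iff_eq_inv, inv_div]; field_simp
  have e5 : ∀ y : ℝ, 0 < y → (y⁻¹ + y) / (y⁻¹ - y) = - ((1 + y ^ 2) / (y ^ 2 - 1)) := by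
    intro y hy
    rw [show y⁻¹ - y = -(y ^ 2 - 1) / y by field_simp; ring, show y⁻¹ + y = (1 + y ^ 2) / y by field_simp]
    rw [neg_div, div_neg, div_div_div_cancel_right₀ hy.ne']
  rw [k1 x hx, k1 y hy, e3, e5 x hx, e5 y hy]
  field_simp
  ring

end Rep10

namespace Rep10
open Filter Topology

lemma even_2k (k : ℤ) : Even (2 * k) := even_two_mul k
lemma not_even_2k1 (k : ℤ) : ¬ Even (2 * k + 1) := by rw [Int.not_even_iff_odd]; exact ⟨k, rfl⟩

lemma conv_of_odd {f g : ℤ → ℝ} {N : ℤ} {x : ℝ} (h0 : ∀ k, f (2 * k) * g (N - 2 * k) = 0)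
    (h : HasSum (fun k : ℤ => f (2 * k + 1) * g (N - (2 * k + 1))) x) : ∑' m, f m * g (N - m) = x := by
  have := hasSum_even_odd (f := fun m => f m * g (N - m)) (a := 0) (b := x)
    (by simp only [h0]; exact hasSum_zero) h
  simpa using this.tsum_eq

lemma conv_of_even {f g : ℤ → ℝ} {N : ℤ} {x : ℝ} (h0 : ∀ k, f (2 * k + 1) * g (N - (2 * k + 1)) = 0)
    (h : HasSum (fun k : ℤ => f (2 * k) * g (N - 2 * k)) x) : ∑' m, f m * g (N - m) = x := by
  have := hasSum_even_odd (f := fun m => f m * g (N - m)) (a := x) (b := 0)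
    h (by simp only [h0]; exact hasSum_zero)
  simpa using this.tsum_eq

lemma par1 {N : ℤ} (hN : Even N) (k : ℤ) : Even (N - 2 * k) := hN.sub (even_2k k)
lemma par2 {N : ℤ} (hN : Even N) (k : ℤ) : ¬ Even (N - (2 * k + 1)) := by
  rw [Int.even_sub]; simp [hN, not_even_2k1]
lemma par3 {N : ℤ} (hN : ¬ Even N) (k : ℤ) : ¬ Even (N - 2 * k) := by
  rw [Int.even_sub]; simp [hN]
lemma par4 {N : ℤ} (hN : ¬ Even N) (k : ℤ) : Even (N - (2 * k + 1)) := by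
  rw [Int.even_sub]; simp [hN, not_even_2k1]
lemma ne_of_not_even {n : ℤ} (h : ¬ Even n) : n ≠ 0 := by rintro rfl; simp at h

lemma conv_uv {q : ℝ} (h0 : 0 < q) (h1 : q < 1) (N : ℤ) :
    ∑' m, sU q m * sV q (N - m) = -(1/2) * N * sS q N := by
  apply conv_of_odd
  · intro k; simp [sU]
  by_cases hN : Even N
  · have := (class_sum (TT_odd q) (KK_odd q) (TT_summable h0 h1) (KK_summable h0 h1) 1 (1 - N)).mul_left
      (-(1/2) * ee q N)
    refine hasSum_of_eq this (fun k => ?_) (by simp [sS, hN]; ring)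
    rw [sU, sV, if_neg (not_even_2k1 k), if_neg (par2 hN k), eh_id h0 h1 _ (ne_of_not_even (par2 hN k))]
    ring_nf
  · refine hasSum_of_eq hasSum_zero (fun k => ?_) (by simp [sS, hN])
    simp [sV, par4 hN k]

lemma conv_sv {q : ℝ} (h0 : 0 < q) (h1 : q < 1) (N : ℤ) :
    ∑' m, sS q m * sV q (N - m) = -(1/2) * N * sU q N := by
  apply conv_of_even
  · intro k; simp [sS, not_even_2k1]
  by_cases hN : Even N
  · refine hasSum_of_eq hasSum_zero (fun k => ?_) (by simp [sU, hN])
    simp [sV, par1 hN k]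
  · have := (class_sum (TT_odd q) (KK_odd q) (TT_summable h0 h1) (KK_summable h0 h1) 0 (- N)).mul_left
      (-(1/2) * ee q N)
    refine hasSum_of_eq this (fun k => ?_) (by simp [sU, hN]; ring)
    rw [sS, sV, if_pos (even_2k k), if_neg (par3 hN k), eh_id h0 h1 _ (ne_of_not_even (par3 hN k))]
    ring_nf

lemma conv_su {q : ℝ} (h0 : 0 < q) (h1 : q < 1) (N : ℤ) :
    ∑' m, sS q m * sU q (N - m) = -(1/2) * N * sV q N := by
  apply conv_of_even
  · intro k; simp [sS, not_even_2k1]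
  by_cases hN : Even N
  · refine hasSum_of_eq hasSum_zero (fun k => ?_) (by simp [sV, hN])
    simp [sU, par1 hN k]
  · have := (class_sum (TT_odd q) (TT_odd q) (TT_summable h0 h1) (TT_summable h0 h1) 0 (- N)).mul_left
      (-(1/2) * hh q N)
    refine hasSum_of_eq this (fun k => ?_) (by simp [sV, hN]; ring)
    rw [sS, sU, if_pos (even_2k k), if_neg (par3 hN k), ee_id h0 h1 _ (by
      have := ne_of_not_even hN; omega)]
    ring_nf

lemma conv_ss {q : ℝ} (h0 : 0 < q) (h1 : q < 1) (N : ℤ) (hN0 : N ≠ 0) :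
    ∑' m, sS q m * sS q (N - m) = if Even N then -(1/2) * N * hh q N else 0 := by
  apply conv_of_even
  · intro k; simp [sS, not_even_2k1]
  by_cases hN : Even N
  · have := (class_sum (TT_odd q) (TT_odd q) (TT_summable h0 h1) (TT_summable h0 h1) 0 (- N)).mul_left
      (-(1/2) * hh q N)
    refine hasSum_of_eq this (fun k => ?_) (by simp [hN]; ring)
    rw [sS, sS, if_pos (even_2k k), if_pos (par1 hN k), ee_id h0 h1 _ (by omega)]
    ring_nf
  · refine hasSum_of_eq hasSum_zero (fun k => ?_) (by simp [hN])
    simp [sS, par3 hN k]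

lemma conv_uu {q : ℝ} (h0 : 0 < q) (h1 : q < 1) (N : ℤ) (hN0 : N ≠ 0) :
    ∑' m, sU q m * sU q (N - m) = if Even N then -(1/2) * N * hh q N else 0 := by
  apply conv_of_odd
  · intro k; simp [sU]
  by_cases hN : Even N
  · have := (class_sum (TT_odd q) (TT_odd q) (TT_summable h0 h1) (TT_summable h0 h1) 1 (1 - N)).mul_left
      (-(1/2) * hh q N)
    refine hasSum_of_eq this (fun k => ?_) (by simp [hN]; ring)
    rw [sU, sU, if_neg (not_even_2k1 k), if_neg (par2 hN k), ee_id h0 h1 _ (by omega)]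
    ring_nf
  · refine hasSum_of_eq hasSum_zero (fun k => ?_) (by simp [hN])
    simp [sU, par4 hN k]

lemma conv_vv {q : ℝ} (h0 : 0 < q) (h1 : q < 1) (N : ℤ) (hN0 : N ≠ 0) :
    ∑' m, sV q m * sV q (N - m) = if Even N then -(1/2) * N * hh q N else 0 := by
  apply conv_of_odd
  · intro k; simp [sV]
  by_cases hN : Even N
  · have := (class_sum (KK_odd q) (KK_odd q) (KK_summable h0 h1) (KK_summable h0 h1) 1 (1 - N)).mul_left
      (-(1/2) * hh q N)
    refine hasSum_of_eq this (fun k => ?_) (by simp [hN]; ring)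
    rw [sV, sV, if_neg (not_even_2k1 k), if_neg (par2 hN k), hh_id h0 h1 (ne_of_not_even (not_even_2k1 k))
      (ne_of_not_even (par2 hN k)) (by omega)]
    ring_nf
  · refine hasSum_of_eq hasSum_zero (fun k => ?_) (by simp [hN])
    simp [sV, par4 hN k]

/-! ### Weighted generating functions -/

/-- decay of a two-sided sequence -/
def Dec (r : ℝ) (w : ℤ → ℝ) : Prop := ∃ C, ∀ n : ℤ, |w n| ≤ C * (r ^ 2) ^ n.natAbs

noncomputable def gt (w : ℤ → ℝ) (k : ℕ) (t : ℂ) (n : ℤ) : ℂ := (n : ℂ) ^ k * (w n : ℂ) * t ^ n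
noncomputable def G (w : ℤ → ℝ) (k : ℕ) (t : ℂ) : ℂ := ∑' n : ℤ, gt w k t n

lemma dec_S {r : ℝ} (h0 : 0 < r) : Dec r (sS (r ^ 2)) :=
  ⟨1, fun n => by
    rw [sS]; split_ifs
    · simpa using ee_bound (pow_pos h0 2) n
    · simp; positivity⟩

lemma dec_U {r : ℝ} (h0 : 0 < r) : Dec r (sU (r ^ 2)) :=
  ⟨1, fun n => by
    rw [sU]; split_ifs
    · simp; positivity
    · simpa using ee_bound (pow_pos h0 2) n⟩

lemma dec_V {r : ℝ} (h0 : 0 < r) (h1 : r < 1) : Dec r (sV (r ^ 2)) :=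
  ⟨(1 - r ^ 2)⁻¹, fun n => by
    have := (pow_pos_lt h0 h1 2 two_ne_zero).2
    rw [sV]; split_ifs
    · have : 0 < 1 - r ^ 2 := by linarith
      simp; positivity
    · exact hh_bound (pow_pos h0 2) this n⟩

lemma summable_gt {r : ℝ} (h0 : 0 < r) (h1 : r < 1) {w : ℤ → ℝ} (hw : Dec r w) (k : ℕ) {t : ℂ}
    (ht : r ≤ ‖t‖) (ht' : ‖t‖ ≤ r⁻¹) : Summable fun n => ‖gt w k t n‖ := by
  obtain ⟨C, hC⟩ := hw
  refine Summable.of_nonneg_of_le (fun _ => norm_nonneg _) (fun n => ?_)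
    ((summable_int_pow_mul_geom k h0 h1).mul_left C)
  rw [gt, norm_mul, norm_mul, norm_pow, norm_zpow, Complex.norm_intCast, Complex.norm_real, Real.norm_eq_abs]
  have h2 := zpow_le_of_bounds h0 ht ht' n
  have hk : 0 ≤ |(n:ℝ)| ^ k := by positivity
  have hr : 0 < r ^ n.natAbs := by positivity
  calc |(n:ℝ)| ^ k * |w n| * ‖t‖ ^ n ≤ |(n:ℝ)| ^ k * (C * (r ^ 2) ^ n.natAbs) * (r ^ n.natAbs)⁻¹ := by
        have := (abs_nonneg _).trans (hC n)
        have := hC n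
        gcongr
    _ = C * (|(n:ℝ)| ^ k * r ^ n.natAbs) := by
        rw [← pow_mul, mul_comm 2, pow_mul]; field_simp

lemma conv_gt {r : ℝ} (h0 : 0 < r) (h1 : r < 1) {w1 w2 : ℤ → ℝ} (hw1 : Dec r w1) (hw2 : Dec r w2) {t : ℂ}
    (ht : r ≤ ‖t‖) (ht' : ‖t‖ ≤ r⁻¹) (i j : ℕ) :
    HasSum (fun N => ∑' m, gt w1 i t m * gt w2 j t (N - m)) (G w1 i t * G w2 j t) :=
  tsum_conv (summable_gt h0 h1 hw1 i ht ht') (summable_gt h0 h1 hw2 j ht ht')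

lemma conv_summable {r : ℝ} (h0 : 0 < r) (h1 : r < 1) {w1 w2 : ℤ → ℝ} (hw1 : Dec r w1) (hw2 : Dec r w2) {t : ℂ}
    (ht : r ≤ ‖t‖) (ht' : ‖t‖ ≤ r⁻¹) (i j : ℕ) (N : ℤ) :
    Summable (fun m => gt w1 i t m * gt w2 j t (N - m)) := by
  have s1 := summable_gt h0 h1 hw1 i ht ht'
  have s2 := summable_gt h0 h1 hw2 j ht ht'
  have hb : ∀ m, ‖gt w2 j t m‖ ≤ ∑' m, ‖gt w2 j t m‖ := fun m => s2.le_tsum m fun _ _ => norm_nonneg _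
  refine Summable.of_norm_bounded (s1.mul_right (∑' m, ‖gt w2 j t m‖)) fun m => ?_
  rw [norm_mul]
  gcongr
  exact hb _

lemma conv_base {w1 w2 w3 : ℤ → ℝ} (hc : ∀ N, ∑' m, w1 m * w2 (N - m) = -(1/2) * N * w3 N) {t : ℂ} (ht : t ≠ 0)
    (N : ℤ) : ∑' m, gt w1 0 t m * gt w2 0 t (N - m) = -(1/2) * gt w3 1 t N := by
  have : ∀ m, gt w1 0 t m * gt w2 0 t (N - m) = ((w1 m * w2 (N - m) : ℝ) : ℂ) * t ^ N := by
    intro m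
    have : t ^ N = t ^ m * t ^ (N - m) := by rw [← zpow_add₀ ht]; congr 1; ring
    rw [gt, gt, this]; push_cast; ring
  simp only [this]
  rw [tsum_mul_right, ← Complex.ofReal_tsum, hc, gt]
  push_cast; ring

lemma gt_succ (w : ℤ → ℝ) (k : ℕ) (t : ℂ) (n : ℤ) : gt w (k + 1) t n = n * gt w k t n := by
  rw [gt, gt]; ring

lemma ne_of_norm {r : ℝ} (h0 : 0 < r) {t : ℂ} (ht : r ≤ ‖t‖) : t ≠ 0 := by
  rintro rfl; simp at ht; linarith

lemma conv1 {r : ℝ} (h0 : 0 < r) (h1 : r < 1) {w1 w2 w3 : ℤ → ℝ} (hw1 : Dec r w1) (hw2 : Dec r w2)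
    (hc : ∀ N, ∑' m, w1 m * w2 (N - m) = -(1/2) * N * w3 N) {t : ℂ}
    (ht : r ≤ ‖t‖) (ht' : ‖t‖ ≤ r⁻¹) : G w3 1 t = -2 * (G w1 0 t * G w2 0 t) := by
  have := (conv_gt h0 h1 hw1 hw2 ht ht' 0 0).mul_left (-2)
  simp only [conv_base hc (ne_of_norm h0 ht)] at this
  rw [← this.tsum_eq, G]
  exact tsum_congr fun n => by ring

lemma conv2 {r : ℝ} (h0 : 0 < r) (h1 : r < 1) {w1 w2 w3 : ℤ → ℝ} (hw1 : Dec r w1) (hw2 : Dec r w2)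
    (hc : ∀ N, ∑' m, w1 m * w2 (N - m) = -(1/2) * N * w3 N) {t : ℂ}
    (ht : r ≤ ‖t‖) (ht' : ‖t‖ ≤ r⁻¹) : G w3 2 t = -2 * (G w1 1 t * G w2 0 t + G w1 0 t * G w2 1 t) := by
  have := ((conv_gt h0 h1 hw1 hw2 ht ht' 1 0).add (conv_gt h0 h1 hw1 hw2 ht ht' 0 1)).mul_left (-2)
  rw [← this.tsum_eq, G]
  refine tsum_congr fun N => ?_
  rw [← (conv_summable h0 h1 hw1 hw2 ht ht' 1 0 N).tsum_add (conv_summable h0 h1 hw1 hw2 ht ht' 0 1 N)]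
  have : ∀ m, gt w1 1 t m * gt w2 0 t (N - m) + gt w1 0 t m * gt w2 1 t (N - m)
      = N * (gt w1 0 t m * gt w2 0 t (N - m)) := by
    intro m
    rw [gt_succ w1, gt_succ w2]; push_cast; ring
  simp only [this]
  rw [tsum_mul_left, conv_base hc (ne_of_norm h0 ht), gt_succ]; ring

lemma conv3 {r : ℝ} (h0 : 0 < r) (h1 : r < 1) {w1 w2 w3 : ℤ → ℝ} (hw1 : Dec r w1) (hw2 : Dec r w2)
    (hc : ∀ N, ∑' m, w1 m * w2 (N - m) = -(1/2) * N * w3 N) {t : ℂ}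
    (ht : r ≤ ‖t‖) (ht' : ‖t‖ ≤ r⁻¹) :
    G w3 3 t = -2 * (G w1 2 t * G w2 0 t + 2 * (G w1 1 t * G w2 1 t) + G w1 0 t * G w2 2 t) := by
  have := (((conv_gt h0 h1 hw1 hw2 ht ht' 2 0).add ((conv_gt h0 h1 hw1 hw2 ht ht' 1 1).mul_left 2)).add
    (conv_gt h0 h1 hw1 hw2 ht ht' 0 2)).mul_left (-2)
  rw [← this.tsum_eq, G]
  refine tsum_congr fun N => ?_
  have s1 := conv_summable h0 h1 hw1 hw2 ht ht' 2 0 N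
  have s2 := (conv_summable h0 h1 hw1 hw2 ht ht' 1 1 N).mul_left 2
  have s3 := conv_summable h0 h1 hw1 hw2 ht ht' 0 2 N
  rw [← tsum_mul_left, ← s1.tsum_add s2, ← (s1.add s2).tsum_add s3]
  have : ∀ m, gt w1 2 t m * gt w2 0 t (N - m) + 2 * (gt w1 1 t m * gt w2 1 t (N - m))
       + gt w1 0 t m * gt w2 2 t (N - m)
      = N ^ 2 * (gt w1 0 t m * gt w2 0 t (N - m)) := by
    intro m
    rw [gt_succ w1 1, gt_succ w2 1, gt_succ w1, gt_succ w2]; push_cast; ring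
  simp only [this]
  rw [tsum_mul_left, conv_base hc (ne_of_norm h0 ht), gt_succ _ 2, gt_succ _ 1]; ring

lemma sq_diff {r : ℝ} (h0 : 0 < r) (h1 : r < 1) {w1 w2 : ℤ → ℝ} (hw1 : Dec r w1) (hw2 : Dec r w2)
    (hc : ∀ N, N ≠ 0 → ∑' m, w1 m * w1 (N - m) = ∑' m, w2 m * w2 (N - m)) {t : ℂ}
    (ht : r ≤ ‖t‖) (ht' : ‖t‖ ≤ r⁻¹) :
    G w1 0 t ^ 2 - G w2 0 t ^ 2 = ((∑' m, w1 m * w1 (0 - m) - ∑' m, w2 m * w2 (0 - m) : ℝ) : ℂ) := by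
  have key : ∀ (w : ℤ → ℝ) (N : ℤ), ∑' m, gt w 0 t m * gt w 0 t (N - m) =
      ((∑' m, w m * w (N - m) : ℝ) : ℂ) * t ^ N := by
    intro w N
    rw [Complex.ofReal_tsum, ← tsum_mul_right]
    refine tsum_congr fun m => ?_
    have : t ^ N = t ^ m * t ^ (N - m) := by rw [← zpow_add₀ (ne_of_norm h0 ht)]; congr 1; ring
    rw [gt, gt, this]; push_cast; ring
  have := (conv_gt h0 h1 hw1 hw1 ht ht' 0 0).sub (conv_gt h0 h1 hw2 hw2 ht ht' 0 0)
  simp only [key] at this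
  rw [sq, sq]
  refine this.unique ?_
  have h := hasSum_single (f := fun N => ((∑' m, w1 m * w1 (N - m) : ℝ) : ℂ) * t ^ N
    - ((∑' m, w2 m * w2 (N - m) : ℝ) : ℂ) * t ^ N) 0 (fun N hN => by rw [hc N hN]; ring)
  simpa using h

lemma S3_eq {r : ℝ} (h0 : 0 < r) (h1 : r < 1) {t : ℂ} (ht : r ≤ ‖t‖) (ht' : ‖t‖ ≤ r⁻¹) :
    G (sS (r ^ 2)) 3 t = -8 * (G (sU (r ^ 2)) 0 t * G (sV (r ^ 2)) 0 t) *
      (G (sU (r ^ 2)) 0 t ^ 2 + G (sV (r ^ 2)) 0 t ^ 2 + 4 * G (sS (r ^ 2)) 0 t ^ 2) := by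
  have hq := pow_pos_lt h0 h1 2 two_ne_zero
  have s1 := conv1 h0 h1 (dec_U h0) (dec_V h0 h1) (conv_uv hq.1 hq.2) ht ht'
  have u1 := conv1 h0 h1 (dec_S h0) (dec_V h0 h1) (conv_sv hq.1 hq.2) ht ht'
  have v1 := conv1 h0 h1 (dec_S h0) (dec_U h0) (conv_su hq.1 hq.2) ht ht'
  have u2 := conv2 h0 h1 (dec_S h0) (dec_V h0 h1) (conv_sv hq.1 hq.2) ht ht'
  have v2 := conv2 h0 h1 (dec_S h0) (dec_U h0) (conv_su hq.1 hq.2) ht ht'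
  rw [conv3 h0 h1 (dec_U h0) (dec_V h0 h1) (conv_uv hq.1 hq.2) ht ht', u2, v2, u1, v1, s1]
  ring

lemma V3_eq {r : ℝ} (h0 : 0 < r) (h1 : r < 1) {t : ℂ} (ht : r ≤ ‖t‖) (ht' : ‖t‖ ≤ r⁻¹) :
    G (sV (r ^ 2)) 3 t = -8 * (G (sS (r ^ 2)) 0 t * G (sU (r ^ 2)) 0 t) *
      (G (sS (r ^ 2)) 0 t ^ 2 + G (sU (r ^ 2)) 0 t ^ 2 + 4 * G (sV (r ^ 2)) 0 t ^ 2) := by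
  have hq := pow_pos_lt h0 h1 2 two_ne_zero
  have s1 := conv1 h0 h1 (dec_U h0) (dec_V h0 h1) (conv_uv hq.1 hq.2) ht ht'
  have u1 := conv1 h0 h1 (dec_S h0) (dec_V h0 h1) (conv_sv hq.1 hq.2) ht ht'
  have v1 := conv1 h0 h1 (dec_S h0) (dec_U h0) (conv_su hq.1 hq.2) ht ht'
  have u2 := conv2 h0 h1 (dec_S h0) (dec_V h0 h1) (conv_sv hq.1 hq.2) ht ht'
  have s2 := conv2 h0 h1 (dec_U h0) (dec_V h0 h1) (conv_uv hq.1 hq.2) ht ht'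
  rw [conv3 h0 h1 (dec_S h0) (dec_U h0) (conv_su hq.1 hq.2) ht ht', u2, s2, u1, v1, s1]
  ring

lemma SU_diff {r : ℝ} (h0 : 0 < r) (h1 : r < 1) {t t' : ℂ} (ht : r ≤ ‖t‖) (ht' : ‖t‖ ≤ r⁻¹)
    (hs : r ≤ ‖t'‖) (hs' : ‖t'‖ ≤ r⁻¹) :
    G (sS (r ^ 2)) 0 t ^ 2 - G (sU (r ^ 2)) 0 t ^ 2 = G (sS (r ^ 2)) 0 t' ^ 2 - G (sU (r ^ 2)) 0 t' ^ 2 := by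
  have hq := pow_pos_lt h0 h1 2 two_ne_zero
  have hc : ∀ N : ℤ, N ≠ 0 → _ = _ := fun N hN =>
    (conv_ss hq.1 hq.2 N hN).trans (conv_uu hq.1 hq.2 N hN).symm
  rw [sq_diff h0 h1 (dec_S h0) (dec_U h0) hc ht ht', sq_diff h0 h1 (dec_S h0) (dec_U h0) hc hs hs']

lemma SV_diff {r : ℝ} (h0 : 0 < r) (h1 : r < 1) {t t' : ℂ} (ht : r ≤ ‖t‖) (ht' : ‖t‖ ≤ r⁻¹)
    (hs : r ≤ ‖t'‖) (hs' : ‖t'‖ ≤ r⁻¹) :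
    G (sS (r ^ 2)) 0 t ^ 2 - G (sV (r ^ 2)) 0 t ^ 2 = G (sS (r ^ 2)) 0 t' ^ 2 - G (sV (r ^ 2)) 0 t' ^ 2 := by
  have hq := pow_pos_lt h0 h1 2 two_ne_zero
  have hc : ∀ N : ℤ, N ≠ 0 → _ = _ := fun N hN =>
    (conv_ss hq.1 hq.2 N hN).trans (conv_vv hq.1 hq.2 N hN).symm
  rw [sq_diff h0 h1 (dec_S h0) (dec_V h0 h1) hc ht ht', sq_diff h0 h1 (dec_S h0) (dec_V h0 h1) hc hs hs']

end Rep10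

namespace Rep10
open Filter Topology

lemma lim_tsum {F : ℝ → ℤ → ℝ} {c : ℝ} (h : ∀ y, 0 < y → y < 1 → ∀ k : ℤ, k ≠ 0 → |F y k| ≤ y ^ k.natAbs)
    (hF : ∀ y, 0 < y → F y 0 = c) : Tendsto (fun y => ∑' k, F y k) (𝓝[>] 0) (𝓝 c) := by
  have hsum : Summable fun k : ℤ => (|c| + 1) * (1/2 : ℝ) ^ k.natAbs :=
    (summable_int_geom (by norm_num) (by norm_num)).mul_left _
  have hev : ∀ᶠ y : ℝ in 𝓝[>] 0, 0 < y ∧ y ≤ 1/2 := by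
    filter_upwards [Ioo_mem_nhdsGT (show (0:ℝ) < 1/2 by norm_num)] with y hy
    exact ⟨hy.1, hy.2.le⟩
  have := tendsto_tsum_of_dominated_convergence (𝓕 := 𝓝[>] (0:ℝ)) (f := F)
    (g := fun k => if k = 0 then c else 0) hsum (by
      intro k
      by_cases hk : k = 0
      · subst hk
        simp only [if_true]
        refine tendsto_const_nhds.congr' ?_
        filter_upwards [hev] with y hy
        exact (hF y hy.1).symm
      · simp only [hk, if_false]
        have hz : Tendsto (fun y : ℝ => y) (𝓝[>] 0) (𝓝 0) := tendsto_nhdsWithin_of_tendsto_nhds tendsto_id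
        refine squeeze_zero_norm' ?_ hz
        filter_upwards [hev] with y hy
        rw [Real.norm_eq_abs]
        refine (h y hy.1 (by linarith [hy.2]) k hk).trans ?_
        have : 1 ≤ k.natAbs := by omega
        simpa using pow_le_pow_of_le_one hy.1.le (by linarith [hy.2]) this) (by
      filter_upwards [hev] with y hy k
      by_cases hk : k = 0
      · subst hk; rw [hF y hy.1]; simp
      · rw [Real.norm_eq_abs]
        refine (h y hy.1 (by linarith [hy.2]) k hk).trans ?_
        have h1 : y ^ k.natAbs ≤ (1/2 : ℝ) ^ k.natAbs := pow_le_pow_left₀ hy.1.le hy.2 _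
        have h2 : 0 < (1/2 : ℝ) ^ k.natAbs := by positivity
        nlinarith [abs_nonneg c])
  rwa [tsum_ite_eq] at this

lemma rec_lim {M : ℝ → ℝ} {L R : ℝ} (hR : R ≤ 1) (hM : ∀ q, 0 < q → q < R → M q = M (q ^ 2))
    (hL : Tendsto M (𝓝[>] 0) (𝓝 L)) {q : ℝ} (h0 : 0 < q) (h1 : q < R) : M q = L := by
  have hb : ∀ j : ℕ, 0 < q ^ (2 ^ j) ∧ q ^ (2 ^ j) < R := fun j =>
    ⟨by positivity, lt_of_le_of_lt (by
      simpa using pow_le_pow_of_le_one h0.le (h1.le.trans hR) (Nat.one_le_two_pow (n := j))) h1⟩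
  have hc : ∀ j : ℕ, M (q ^ (2 ^ j)) = M q := by
    intro j
    induction j with
    | zero => simp
    | succ j ih => rw [← ih, hM _ (hb j).1 (hb j).2, ← pow_mul, pow_succ]
  have ht : Tendsto (fun j : ℕ => q ^ (2 ^ j)) atTop (𝓝[>] 0) := by
    refine tendsto_nhdsWithin_iff.2 ⟨?_, Eventually.of_forall fun j => (hb j).1⟩
    exact (tendsto_pow_atTop_nhds_zero_of_lt_one h0.le (h1.trans_le hR)).comp
      (tendsto_pow_atTop_atTop_of_one_lt (by norm_num))
  have := hL.comp ht
  have h2 : M ∘ (fun j : ℕ => q ^ (2 ^ j)) = fun _ => M q := funext hc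
  rw [h2] at this
  exact tendsto_nhds_unique tendsto_const_nhds this

lemma natAbs_le_sq_toNat (k : ℤ) (y : ℝ) (h0 : 0 < y) (h1 : y < 1) : y ^ (k ^ 2) ≤ y ^ k.natAbs := by
  rw [← Int.natAbs_sq, ← Nat.cast_pow, zpow_natCast]
  exact pow_le_pow_of_le_one h0.le h1.le (by nlinarith [Nat.zero_le k.natAbs, sq k.natAbs, Nat.le_mul_self k.natAbs])

lemma lim_ph : Tendsto ph (𝓝[>] 0) (𝓝 1) := by
  refine lim_tsum (F := fun q n => q ^ (n ^ 2)) (fun y h0 h1 k _ => ?_) (fun y _ => by simp)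
  rw [abs_of_pos (by positivity)]
  exact natAbs_le_sq_toNat k y h0 h1

lemma lim_pm : Tendsto pm (𝓝[>] 0) (𝓝 1) := by
  refine lim_tsum (F := fun q n => q ^ (n ^ 2) * (-1) ^ n) (fun y h0 h1 k _ => ?_) (fun y _ => by simp)
  rw [abs_mul, abs_of_pos (by positivity), abs_zpow]
  simpa using natAbs_le_sq_toNat k y h0 h1

lemma tendsto_sq : Tendsto (fun y : ℝ => y ^ 2) (𝓝[>] 0) (𝓝[>] 0) := by
  refine tendsto_nhdsWithin_iff.2 ⟨tendsto_nhdsWithin_of_tendsto_nhds ?_, ?_⟩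
  · have : Continuous fun y : ℝ => y ^ 2 := by fun_prop
    simpa using this.tendsto 0
  · filter_upwards [self_mem_nhdsWithin] with y hy
    exact Set.mem_Ioi.2 (pow_pos (Set.mem_Ioi.1 hy) 2)

/-! ### theta quotient -/

noncomputable def thC (Q : ℝ) (x : ℂ) : ℂ := ∑' k : ℤ, (Q : ℂ) ^ (k ^ 2) * x ^ k
noncomputable def Sx (q : ℝ) (x : ℂ) : ℂ := ∑' k : ℤ, (ee q (2 * k) : ℂ) * x ^ k
noncomputable def wN (q : ℝ) (N : ℤ) : ℝ := ∑' m : ℤ, ee q (2 * m) * ((-1) ^ (N - m) * (q ^ 2) ^ ((N - m) ^ 2))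

lemma ee_le_one {q : ℝ} (h0 : 0 < q) (h1 : q < 1) (n : ℤ) : ee q n ≤ 1 := by
  have := ee_bound h0 n
  rw [abs_of_nonneg (ee_nonneg h0 n)] at this
  exact this.trans (pow_le_one₀ h0.le h1.le)

lemma summable_wN {q : ℝ} (h0 : 0 < q) (h1 : q < 1) (N : ℤ) :
    Summable fun m : ℤ => ee q (2 * m) * ((-1) ^ (N - m) * (q ^ 2) ^ ((N - m) ^ 2)) := by
  have hq := pow_pos_lt h0 h1 2 two_ne_zero
  have := ((Equiv.subLeft N).summable_iff.2 (summable_ph hq.1 hq.2))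
  refine Summable.of_norm_bounded this fun m => ?_
  simp only [Function.comp, Equiv.subLeft_apply]
  rw [norm_mul, norm_mul, norm_zpow, norm_neg, norm_one, one_zpow, one_mul, Real.norm_eq_abs, Real.norm_eq_abs,
    abs_of_nonneg (ee_nonneg h0 _), abs_of_pos (by positivity)]
  have : 0 < (q ^ 2) ^ ((N - m) ^ 2) := by positivity
  have := ee_le_one h0 h1 (2 * m)
  nlinarith

lemma ee_two {q : ℝ} (h0 : 0 < q) (m : ℤ) : ee q (2 * m) * ((q ^ 2) ^ m + (q ^ 2) ^ (-m)) = 1 := by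
  rw [ee]
  have e : ∀ m : ℤ, (q ^ 2) ^ m = q ^ (2 * m) := fun m => by rw [zpow_mul]; norm_cast
  rw [e, e, mul_neg]
  have : 0 < q ^ (2 * m) + q ^ (-(2 * m)) := by positivity
  exact inv_mul_cancel₀ this.ne'

lemma wN_succ {q : ℝ} (h0 : 0 < q) (h1 : q < 1) (N : ℤ) :
    wN q (N + 1) = (q ^ 2) ^ (2 * N + 1) * wN q N := by
  have hQ : (q ^ 2) ≠ 0 := by positivity
  have h := ((summable_wN h0 h1 N).mul_left ((q ^ 2) ^ (2 * N + 1))).tsum_sub (summable_wN h0 h1 (N + 1))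
  rw [tsum_mul_left] at h
  have e : ∀ m : ℤ, (q ^ 2) ^ (2 * N + 1) * (ee q (2 * m) * ((-1) ^ (N - m) * (q ^ 2) ^ ((N - m) ^ 2)))
      - ee q (2 * m) * ((-1) ^ (N + 1 - m) * (q ^ 2) ^ ((N + 1 - m) ^ 2))
      = (-1) ^ (N - m) * (q ^ 2) ^ ((N - m) ^ 2 + 2 * N + 1 - m) := by
    intro m
    have a1 : (q ^ 2) ^ (2 * N + 1) * (q ^ 2) ^ ((N - m) ^ 2)
        = (q ^ 2) ^ ((N - m) ^ 2 + 2 * N + 1 - m) * (q ^ 2) ^ m := by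
      rw [← zpow_add₀ hQ, ← zpow_add₀ hQ]; congr 1; ring
    have a2 : (q ^ 2) ^ ((N + 1 - m) ^ 2)
        = (q ^ 2) ^ ((N - m) ^ 2 + 2 * N + 1 - m) * (q ^ 2) ^ (-m) := by
      rw [← zpow_add₀ hQ]; congr 1; ring
    have a3 : (-1 : ℝ) ^ (N + 1 - m) = - (-1) ^ (N - m) := by
      rw [show N + 1 - m = N - m + 1 by ring, zpow_add_one₀ (by norm_num)]; ring
    rw [a2, a3]
    calc _ = (-1) ^ (N - m) * ee q (2 * m) * ((q ^ 2) ^ (2 * N + 1) * (q ^ 2) ^ ((N - m) ^ 2)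
            + (q ^ 2) ^ ((N - m) ^ 2 + 2 * N + 1 - m) * (q ^ 2) ^ (-m)) := by ring
      _ = (-1) ^ (N - m) * (q ^ 2) ^ ((N - m) ^ 2 + 2 * N + 1 - m) *
          (ee q (2 * m) * ((q ^ 2) ^ m + (q ^ 2) ^ (-m))) := by rw [a1]; ring
      _ = _ := by rw [ee_two h0, mul_one]
  simp only [e] at h
  have z : ∑' m : ℤ, (-1 : ℝ) ^ (N - m) * (q ^ 2) ^ ((N - m) ^ 2 + 2 * N + 1 - m) = 0 := by
    have h2 := (Equiv.subLeft (2 * N + 1)).tsum_eq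
      (fun m : ℤ => (-1 : ℝ) ^ (N - m) * (q ^ 2) ^ ((N - m) ^ 2 + 2 * N + 1 - m))
    have h3 : ∀ m : ℤ, (-1 : ℝ) ^ (N - (Equiv.subLeft (2 * N + 1) m)) *
        (q ^ 2) ^ ((N - (Equiv.subLeft (2 * N + 1) m)) ^ 2 + 2 * N + 1 - (Equiv.subLeft (2 * N + 1) m))
        = - ((-1 : ℝ) ^ (N - m) * (q ^ 2) ^ ((N - m) ^ 2 + 2 * N + 1 - m)) := by
      intro m
      rw [Equiv.subLeft_apply]
      have b1 : (-1 : ℝ) ^ (N - (2 * N + 1 - m)) = - (-1) ^ (N - m) := by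
        rw [show N - (2 * N + 1 - m) = -(N - m) + (-1) by ring, zpow_add₀ (by norm_num), zpow_neg, ← inv_zpow]
        norm_num
      rw [b1, show (N - (2 * N + 1 - m)) ^ 2 + 2 * N + 1 - (2 * N + 1 - m) = (N - m) ^ 2 + 2 * N + 1 - m by ring]
      ring
    simp only [h3] at h2
    rw [tsum_neg] at h2
    linarith
  rw [z] at h
  simp only [wN]
  linarith

lemma wN_eq {q : ℝ} (h0 : 0 < q) (h1 : q < 1) (N : ℤ) : wN q N = (q ^ 2) ^ (N ^ 2) * wN q 0 := by
  have hQ : (q ^ 2) ≠ 0 := by positivity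
  induction N using Int.induction_on with
  | zero => simp
  | succ i ih =>
    rw [wN_succ h0 h1, ih, ← mul_assoc, ← zpow_add₀ hQ]; congr 2; ring
  | pred i ih =>
    have := wN_succ h0 h1 (-i - 1)
    rw [show (-(i:ℤ) - 1 + 1) = -i by ring, ih] at this
    have h2 : (q ^ 2) ^ ((-(i:ℤ)) ^ 2) = (q ^ 2) ^ (2 * (-(i:ℤ) - 1) + 1) * (q ^ 2) ^ ((-(i:ℤ) - 1) ^ 2) := by
      rw [← zpow_add₀ hQ]; congr 1; ring
    rw [h2, mul_assoc] at this
    exact (mul_left_cancel₀ (zpow_ne_zero _ hQ) this).symm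

lemma ee2_bound {q : ℝ} (h0 : 0 < q) (m : ℤ) : |ee q (2 * m)| ≤ (q ^ 2) ^ m.natAbs := by
  have := ee_bound h0 (2 * m)
  rwa [Int.natAbs_mul, show Int.natAbs 2 = 2 from rfl, pow_mul] at this

lemma summable_Sx {q : ℝ} (h0 : 0 < q) (h1 : q < 1) {x : ℂ} (hx : q ≤ ‖x‖) (hx' : ‖x‖ ≤ q⁻¹) :
    Summable fun k : ℤ => ‖(ee q (2 * k) : ℂ) * x ^ k‖ := by
  refine Summable.of_nonneg_of_le (fun _ => norm_nonneg _) (fun n => ?_) (summable_int_geom h0 h1)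
  rw [norm_mul, norm_zpow, Complex.norm_real, Real.norm_eq_abs]
  have h2 := zpow_le_of_bounds h0 hx hx' n
  have hr : 0 < q ^ n.natAbs := by positivity
  calc |ee q (2 * n)| * ‖x‖ ^ n ≤ (q ^ 2) ^ n.natAbs * (q ^ n.natAbs)⁻¹ := by
        have := ee2_bound h0 n
        gcongr
    _ = q ^ n.natAbs := by
        rw [← pow_mul, mul_comm 2, pow_mul]; field_simp

lemma S_theta {q : ℝ} (h0 : 0 < q) (h1 : q < 1) {x : ℂ} (hx : q ≤ ‖x‖) (hx' : ‖x‖ ≤ q⁻¹) :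
    Sx q x * thC (q ^ 2) (-x) = wN q 0 * thC (q ^ 2) x := by
  have hq := pow_pos_lt h0 h1 2 two_ne_zero
  have hqq : q ^ 2 ≤ q := by nlinarith
  have hx0 := ne_of_norm h0 hx
  have hc := tsum_conv (summable_Sx h0 h1 hx hx') (summable_theta_norm hq.1 hq.2 (x := -x)
    (by rw [norm_neg]; linarith) (by rw [norm_neg]; exact hx'.trans (inv_anti₀ hq.1 hqq)))
  rw [Sx, thC, thC, ← hc.tsum_eq, ← tsum_mul_left]
  refine tsum_congr fun N => ?_
  have e : ∀ m : ℤ, (ee q (2 * m) : ℂ) * x ^ m * (((q ^ 2 : ℝ) : ℂ) ^ ((N - m) ^ 2) * (-x) ^ (N - m))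
      = x ^ N * ((ee q (2 * m) * ((-1) ^ (N - m) * (q ^ 2) ^ ((N - m) ^ 2)) : ℝ) : ℂ) := by
    intro m
    have : x ^ N = x ^ m * x ^ (N - m) := by rw [← zpow_add₀ hx0]; congr 1; ring
    rw [this, neg_eq_neg_one_mul x, mul_zpow]
    push_cast; ring
  simp only [e]
  rw [tsum_mul_left, ← Complex.ofReal_tsum]
  have := wN_eq h0 h1 N
  rw [wN] at this
  rw [this]
  push_cast; ring

end Rep10

namespace Rep10
open Filter Topology

lemma thC_one (Q : ℝ) : thC Q 1 = ph Q := by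
  rw [thC, ph, Complex.ofReal_tsum]; simp

lemma thC_neg_one (Q : ℝ) : thC Q (-1) = pm Q := by
  rw [thC, pm, Complex.ofReal_tsum]; simp

lemma thC_q {q : ℝ} (h0 : 0 < q) : thC (q ^ 2) q = ps q := by
  rw [thC, ps, Complex.ofReal_tsum]
  refine tsum_congr fun k => ?_
  have hq : (q : ℂ) ≠ 0 := by exact_mod_cast h0.ne'
  push_cast
  rw [zpow_add₀ hq, zpow_mul]; norm_cast

lemma thC_neg_q {q : ℝ} (h0 : 0 < q) : thC (q ^ 2) (-q) = pms q := by
  rw [thC, pms, Complex.ofReal_tsum]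
  refine tsum_congr fun k => ?_
  have hq : (q : ℂ) ≠ 0 := by exact_mod_cast h0.ne'
  push_cast
  rw [zpow_add₀ hq, zpow_mul, neg_eq_neg_one_mul (q : ℂ), mul_zpow, mul_comm ((-1 : ℂ) ^ k), mul_assoc]; norm_cast

lemma thC_I {Q : ℝ} (h0 : 0 < Q) (h1 : Q < 1) {x : ℂ} (hx : x ^ 2 = -1) : thC Q x = pm (Q ^ 4) := by
  have hx0 : x ≠ 0 := by rintro rfl; norm_num at hx
  have hn : ‖x‖ = 1 := by
    have : ‖x‖ ^ 2 = 1 := by rw [← norm_pow, hx]; simp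
    nlinarith [norm_nonneg x, sq_nonneg (‖x‖ - 1)]
  have hs := (summable_theta_norm h0 h1 (x := x) (by rw [hn]; exact h1.le)
    (by rw [hn]; exact (one_le_inv₀ h0).2 h1.le)).of_norm
  have se := hs.comp_injective (i := fun k : ℤ => 2 * k) (fun x y h => by simpa using h)
  have so := hs.comp_injective (i := fun k : ℤ => 2 * k + 1) (fun x y h => by simpa using h)
  have he : ∑' k : ℤ, ((Q : ℂ) ^ ((2 * k) ^ 2) * x ^ (2 * k)) = pm (Q ^ 4) := by
    rw [pm, Complex.ofReal_tsum]
    refine tsum_congr fun k => ?_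
    rw [← ph4 Q k, zpow_mul x, show x ^ (2 : ℤ) = -1 by exact_mod_cast hx]; push_cast; ring
  have ho : ∑' k : ℤ, ((Q : ℂ) ^ ((2 * k + 1) ^ 2) * x ^ (2 * k + 1)) = 0 := by
    have h2 := (Equiv.subLeft (-1)).tsum_eq
      (fun k : ℤ => ((Q : ℂ) ^ ((2 * k + 1) ^ 2) * x ^ (2 * k + 1)))
    have h3 : ∀ k : ℤ, (Q : ℂ) ^ ((2 * (Equiv.subLeft (-1) k) + 1) ^ 2) * x ^ (2 * (Equiv.subLeft (-1) k) + 1)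
        = - ((Q : ℂ) ^ ((2 * k + 1) ^ 2) * x ^ (2 * k + 1)) := by
      intro k
      rw [Equiv.subLeft_apply, show 2 * (-1 - k) + 1 = -(2 * k + 1) by ring, neg_sq]
      have : x ^ (-(2 * k + 1)) = - x ^ (2 * k + 1) := by
        rw [zpow_neg, zpow_add₀ hx0, zpow_mul, show x ^ (2 : ℤ) = -1 by exact_mod_cast hx, zpow_one, mul_inv,
          ← inv_zpow]
        have : x⁻¹ = -x := inv_eq_of_mul_eq_one_right (by linear_combination -hx)
        rw [this]; norm_num
      rw [this]; ring
    simp only [h3] at h2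
    rw [tsum_neg] at h2
    have : (2 : ℂ) * ∑' k : ℤ, ((Q : ℂ) ^ ((2 * k + 1) ^ 2) * x ^ (2 * k + 1)) = 0 := by linear_combination -h2
    simpa using this
  have := (hasSum_even_odd (f := fun n : ℤ => (Q : ℂ) ^ (n ^ 2) * x ^ n) se.hasSum so.hasSum).tsum_eq
  rw [thC, this]
  exact (congrArg₂ (fun a b : ℂ => a + b) he ho).trans (add_zero _)

lemma norm_ok {q : ℝ} (h0 : 0 < q) (h1 : q < 1) {x : ℂ} (hx : ‖x‖ = 1) : q ≤ ‖x‖ ∧ ‖x‖ ≤ q⁻¹ := by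
  rw [hx]; exact ⟨h1.le, (one_le_inv₀ h0).2 h1.le⟩

lemma Sx_one_aux {q : ℝ} (h0 : 0 < q) (h1 : q < 1) : Sx q 1 * pm (q ^ 2) = wN q 0 * ph (q ^ 2) := by
  have hn := norm_ok h0 h1 (x := 1) (by simp)
  have := S_theta h0 h1 hn.1 hn.2
  rwa [thC_one, thC_neg_one] at this

lemma Sx_neg_aux {q : ℝ} (h0 : 0 < q) (h1 : q < 1) : Sx q (-1) * ph (q ^ 2) = wN q 0 * pm (q ^ 2) := by
  have hn := norm_ok h0 h1 (x := -1) (by simp)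
  have := S_theta h0 h1 hn.1 hn.2
  rwa [neg_neg, thC_one, thC_neg_one] at this

lemma Sx_I_aux {q : ℝ} (h0 : 0 < q) (h1 : q < 1) : Sx q Complex.I = wN q 0 := by
  have hq := pow_pos_lt h0 h1 2 two_ne_zero
  have hq4 := pow_pos_lt hq.1 hq.2 4 (by norm_num)
  have hn := norm_ok h0 h1 (x := Complex.I) (by simp)
  have := S_theta h0 h1 hn.1 hn.2
  rw [thC_I hq.1 hq.2 (by simp), thC_I hq.1 hq.2 (by simp)] at this
  exact mul_right_cancel₀ (by exact_mod_cast (pm_pos hq4.1 hq4.2).ne') this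

lemma Sx_q_aux {q : ℝ} (h0 : 0 < q) (h1 : q < 1) : Sx q q * pm (q ^ 2) = wN q 0 * ph q := by
  have hnq : ‖(q : ℂ)‖ = q := by rw [Complex.norm_real, Real.norm_of_nonneg h0.le]
  have := S_theta h0 h1 (x := q) (by rw [hnq]) (by rw [hnq]; exact h1.le.trans ((one_le_inv₀ h0).2 h1.le))
  rw [thC_q h0, thC_neg_q h0] at this
  have hr : (ps q : ℂ) * pm (q ^ 2) = ph q * pms q := by exact_mod_cast ps_rel h0 h1
  have hne : (pms q : ℂ) ≠ 0 := by exact_mod_cast (pms_pos h0 h1).ne'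
  apply mul_right_cancel₀ hne
  linear_combination (pm (q ^ 2) : ℂ) * this + (wN q 0 : ℂ) * hr

noncomputable def Sone (q : ℝ) : ℝ := ∑' k : ℤ, ee q (2 * k)

lemma Sx_one (q : ℝ) : Sx q 1 = Sone q := by
  rw [Sx, Sone, Complex.ofReal_tsum]; simp

lemma Sone_dup {q : ℝ} (h0 : 0 < q) (h1 : q < 1) : Sx q 1 + Sx q (-1) = 2 * Sone (q ^ 2) := by
  have hn := norm_ok h0 h1 (x := 1) (by simp)
  have hn' := norm_ok h0 h1 (x := -1) (by simp)
  have s1 := (summable_Sx h0 h1 hn.1 hn.2).of_norm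
  have s2 := (summable_Sx h0 h1 hn'.1 hn'.2).of_norm
  rw [Sx, Sx, ← s1.tsum_add s2]
  have hs := s1.add s2
  have se := hs.comp_injective (i := fun k : ℤ => 2 * k) (fun x y h => by simpa using h)
  have he : ∑' k : ℤ, ((ee q (2 * (2 * k)) : ℂ) * 1 ^ (2 * k) + (ee q (2 * (2 * k)) : ℂ) * (-1) ^ (2 * k))
      = 2 * Sone (q ^ 2) := by
    rw [Sone, Complex.ofReal_tsum, ← tsum_mul_left]
    refine tsum_congr fun k => ?_
    have : ee (q ^ 2) (2 * k) = ee q (2 * (2 * k)) := by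
      rw [ee, ee, show -(2 * (2 * k)) = 2 * (-(2 * k)) by ring, zpow_mul q 2, zpow_mul q 2]; norm_cast
    rw [this, one_zpow, Even.neg_one_zpow (even_2k k)]; ring
  have := (hasSum_even_odd (f := fun k : ℤ => (ee q (2 * k) : ℂ) * 1 ^ k + (ee q (2 * k) : ℂ) * (-1) ^ k)
    (b := 0) se.hasSum (by
      refine hasSum_of_eq hasSum_zero (fun k => ?_) rfl
      rw [one_zpow, Odd.neg_one_zpow ⟨k, rfl⟩]; ring)).tsum_eq
  rw [this, add_zero]
  exact he

lemma lim_Sone : Tendsto Sone (𝓝[>] 0) (𝓝 (1/2)) := by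
  refine lim_tsum (F := fun q k => ee q (2 * k)) (fun y h0 h1 k _ => ?_) (fun y _ => by simp [ee]; norm_num)
  refine (ee2_bound h0 k).trans ?_
  have : y ^ 2 ≤ y := by nlinarith
  gcongr

lemma Sone_eq {q : ℝ} (h0 : 0 < q) (h1 : q < 1) : Sone q = 1/2 * ph (q ^ 2) ^ 2 := by
  have := rec_lim (M := fun q => Sone q / ph (q ^ 2) ^ 2) (L := 1/2) le_rfl (by
    intro q h0 h1
    show Sone q / ph (q ^ 2) ^ 2 = Sone (q ^ 2) / ph ((q ^ 2) ^ 2) ^ 2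
    have hq := pow_pos_lt h0 h1 2 two_ne_zero
    have hq4 := pow_pos_lt h0 h1 4 (by norm_num)
    have a1 := Sx_one_aux h0 h1
    have a2 := Sx_neg_aux h0 h1
    have a3 := Sone_dup h0 h1
    have hd := pm_pos hq.1 hq.2
    have hc := ph_pos hq.1 hq.2
    have ha := ph_pos hq4.1 hq4.2
    rw [show (q ^ 2) ^ 2 = q ^ 4 by ring]
    have hs : ph (q ^ 2) ^ 2 + pm (q ^ 2) ^ 2 = 2 * ph (q ^ 4) ^ 2 := by
      rw [ph_sq h0 h1, pm_sq h0 h1, ph_split h0 h1, pm_split h0 h1]; ring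
    rw [div_eq_div_iff (by positivity) (by positivity)]
    rw [Sx_one] at a1 a3
    have hdC : (pm (q ^ 2) : ℂ) ≠ 0 := by exact_mod_cast hd.ne'
    have hcC : (ph (q ^ 2) : ℂ) ≠ 0 := by exact_mod_cast hc.ne'
    have hsC : (ph (q ^ 2) : ℂ) ^ 2 + pm (q ^ 2) ^ 2 = 2 * ph (q ^ 4) ^ 2 := by exact_mod_cast hs
    have : (Sone q : ℂ) * ph (q ^ 4) ^ 2 = Sone (q ^ 2) * ph (q ^ 2) ^ 2 := by
      have e : Sx q (-1) * ph (q ^ 2) ^ 2 = Sone q * pm (q ^ 2) ^ 2 := by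
        linear_combination (ph (q ^ 2) : ℂ) * a2 - (pm (q ^ 2) : ℂ) * a1
      linear_combination (1/2) * ((ph (q ^ 2) : ℂ) ^ 2 * a3 - e - Sone q * hsC)
    exact_mod_cast this) (by
    have := lim_Sone.div ((lim_ph.comp tendsto_sq).pow 2) (by norm_num)
    rw [one_pow, div_one] at this
    exact this) h0 h1
  have hq := pow_pos_lt h0 h1 2 two_ne_zero
  have hc := ph_pos hq.1 hq.2
  rw [div_eq_iff (by positivity)] at this
  exact this

lemma wN_val {q : ℝ} (h0 : 0 < q) (h1 : q < 1) : wN q 0 = 1/2 * ph (q ^ 2) * pm (q ^ 2) := by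
  have hq := pow_pos_lt h0 h1 2 two_ne_zero
  have hc := ph_pos hq.1 hq.2
  have a1 := Sx_one_aux h0 h1
  rw [Sx_one, Sone_eq h0 h1] at a1
  have a2 : 1/2 * ph (q ^ 2) ^ 2 * pm (q ^ 2) = wN q 0 * ph (q ^ 2) := by exact_mod_cast a1
  apply mul_right_cancel₀ hc.ne'
  linarith

lemma Sx1 {q : ℝ} (h0 : 0 < q) (h1 : q < 1) : Sx q 1 = ((1/2 * ph (q ^ 2) ^ 2 : ℝ) : ℂ) := by
  rw [Sx_one, Sone_eq h0 h1]

lemma Sxm1 {q : ℝ} (h0 : 0 < q) (h1 : q < 1) : Sx q (-1) = ((1/2 * pm (q ^ 2) ^ 2 : ℝ) : ℂ) := by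
  have hq := pow_pos_lt h0 h1 2 two_ne_zero
  have hc : (ph (q ^ 2) : ℂ) ≠ 0 := by exact_mod_cast (ph_pos hq.1 hq.2).ne'
  apply mul_right_cancel₀ hc
  rw [Sx_neg_aux h0 h1, wN_val h0 h1]; push_cast; ring

lemma SxI {q : ℝ} (h0 : 0 < q) (h1 : q < 1) : Sx q Complex.I = ((1/2 * ph (q ^ 2) * pm (q ^ 2) : ℝ) : ℂ) := by
  rw [Sx_I_aux h0 h1, wN_val h0 h1]

lemma Sxq {q : ℝ} (h0 : 0 < q) (h1 : q < 1) : Sx q q = ((1/2 * ph (q ^ 2) * ph q : ℝ) : ℂ) := by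
  have hq := pow_pos_lt h0 h1 2 two_ne_zero
  have hc : (pm (q ^ 2) : ℂ) ≠ 0 := by exact_mod_cast (pm_pos hq.1 hq.2).ne'
  apply mul_right_cancel₀ hc
  rw [Sx_q_aux h0 h1, wN_val h0 h1]; push_cast; ring

lemma G_S {r : ℝ} (h0 : 0 < r) (h1 : r < 1) {t : ℂ} (ht : r ≤ ‖t‖) (ht' : ‖t‖ ≤ r⁻¹) :
    G (sS (r ^ 2)) 0 t = Sx (r ^ 2) (t ^ 2) := by
  have hs := (summable_gt h0 h1 (dec_S h0) 0 ht ht').of_norm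
  have se := hs.comp_injective (i := fun k : ℤ => 2 * k) (fun x y h => by simpa using h)
  have := (hasSum_even_odd (f := gt (sS (r ^ 2)) 0 t) (b := 0) se.hasSum (by
      refine hasSum_of_eq hasSum_zero (fun k => ?_) rfl
      simp [gt, sS])).tsum_eq
  rw [G, this, add_zero, Sx]
  refine tsum_congr fun k => ?_
  simp only [Function.comp, gt, sS, if_pos (even_2k k), zpow_mul t 2 k]
  norm_cast
  simp

/-- a primitive eighth root of unity -/
noncomputable def ze : ℂ := (1 + Complex.I) / (√2 : ℝ)

lemma sqrt2_sq : ((√2 : ℝ) : ℂ) ^ 2 = 2 := by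
  norm_cast; simp

lemma sqrt2_ne : ((√2 : ℝ) : ℂ) ≠ 0 := by
  intro h; have := sqrt2_sq; rw [h] at this; norm_num at this

lemma ze_sq : ze ^ 2 = Complex.I := by
  rw [ze, div_pow, sqrt2_sq, add_sq, Complex.I_sq]; ring

lemma ze_ne : ze ≠ 0 := by
  intro h; have := ze_sq; rw [h] at this; simp [eq_comm] at this

lemma ze_norm : ‖ze‖ = 1 := by
  have : ‖ze‖ ^ 2 = 1 := by rw [← norm_pow, ze_sq]; simp
  nlinarith [norm_nonneg ze, sq_nonneg (‖ze‖ - 1)]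

lemma ze_inv : ze⁻¹ = (1 - Complex.I) / (√2 : ℝ) := by
  apply inv_eq_of_mul_eq_one_right
  rw [ze, div_mul_div_comm, ← sq, sqrt2_sq]
  ring_nf
  rw [Complex.I_sq]; norm_num

lemma tsum_symm (f : ℤ → ℂ) : ∑' n, f (-n) = ∑' n, f n := (Equiv.neg ℤ).tsum_eq f

lemma G_zero_of_odd {w : ℤ → ℝ} {t : ℂ} (h : ∀ n, gt w 0 t (-n) = - gt w 0 t n) : G w 0 t = 0 := by
  have := tsum_symm (gt w 0 t)
  simp only [h] at this
  rw [tsum_neg] at this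
  have h2 : (2:ℂ) * ∑' n, gt w 0 t n = 0 := by linear_combination -this
  simpa [G] using h2

lemma sU_even (q : ℝ) (n : ℤ) : sU q (-n) = sU q n := by simp [sU, ee_even]
lemma sS_even (q : ℝ) (n : ℤ) : sS q (-n) = sS q n := by simp [sS, ee_even]
lemma sV_odd (q : ℝ) (n : ℤ) : sV q (-n) = -sV q n := by
  simp only [sV, hh_odd, even_neg]; split_ifs <;> simp

lemma G_U_I (q : ℝ) : G (sU q) 0 Complex.I = 0 := by
  apply G_zero_of_odd
  intro n
  simp only [gt, sU_even]
  by_cases hn : Even n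
  · simp [sU, hn]
  · obtain ⟨k, rfl⟩ := Int.not_even_iff_odd.1 hn
    have : Complex.I ^ (-(2 * k + 1)) = - Complex.I ^ (2 * k + 1) := by
      rw [zpow_neg, ← inv_zpow, Complex.inv_I, Odd.neg_zpow ⟨k, rfl⟩]
    rw [this]; push_cast; ring

lemma G_V_one (q : ℝ) : G (sV q) 0 1 = 0 := by
  apply G_zero_of_odd
  intro n
  simp [gt, sV_odd]

end Rep10

namespace Rep10
open Filter Topology

lemma alg_rel {q : ℝ} (h0 : 0 < q) (h1 : q < 1) :
    ph (q ^ 2) ^ 2 = ph (q ^ 4) ^ 2 + be q ^ 2 ∧ pm (q ^ 2) ^ 2 = ph (q ^ 4) ^ 2 - be q ^ 2 ∧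
      ph q = ph (q ^ 4) + be q ∧ pm q = ph (q ^ 4) - be q := by
  refine ⟨ph_sq h0 h1, ?_, ph_split h0 h1, pm_split h0 h1⟩
  rw [pm_sq h0 h1, ph_split h0 h1, pm_split h0 h1]; ring

lemma G_U_sq {r : ℝ} (h0 : 0 < r) (h1 : r < 1) {t : ℂ} (ht : r ≤ ‖t‖) (ht' : ‖t‖ ≤ r⁻¹) :
    G (sU (r ^ 2)) 0 t ^ 2 = G (sS (r ^ 2)) 0 t ^ 2 - ((1/4 * pm ((r ^ 2) ^ 2) ^ 4 : ℝ) : ℂ) := by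
  have hn := norm_ok h0 h1 (x := Complex.I) (by simp)
  have hq := pow_pos_lt h0 h1 2 two_ne_zero
  have := SU_diff h0 h1 ht ht' hn.1 hn.2
  rw [G_U_I, G_S h0 h1 hn.1 hn.2, Complex.I_sq, Sxm1 hq.1 hq.2] at this
  push_cast at this ⊢
  linear_combination -this

lemma G_V_sq {r : ℝ} (h0 : 0 < r) (h1 : r < 1) {t : ℂ} (ht : r ≤ ‖t‖) (ht' : ‖t‖ ≤ r⁻¹) :
    G (sV (r ^ 2)) 0 t ^ 2 = G (sS (r ^ 2)) 0 t ^ 2 - ((1/4 * ph ((r ^ 2) ^ 2) ^ 4 : ℝ) : ℂ) := by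
  have hn := norm_ok h0 h1 (x := 1) (by simp)
  have hq := pow_pos_lt h0 h1 2 two_ne_zero
  have := SV_diff h0 h1 ht ht' hn.1 hn.2
  rw [G_V_one, G_S h0 h1 hn.1 hn.2, one_pow, Sx1 hq.1 hq.2] at this
  push_cast at this ⊢
  linear_combination -this

lemma norm_r {r : ℝ} (h0 : 0 < r) (h1 : r < 1) : r ≤ ‖(r : ℂ)‖ ∧ ‖(r : ℂ)‖ ≤ r⁻¹ := by
  rw [Complex.norm_real, Real.norm_of_nonneg h0.le]
  exact ⟨le_rfl, h1.le.trans ((one_le_inv₀ h0).2 h1.le)⟩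

lemma G_real (w : ℤ → ℝ) (k : ℕ) (r : ℝ) : G w k r = ((∑' n : ℤ, (n : ℝ) ^ k * w n * r ^ n : ℝ) : ℂ) := by
  rw [G, Complex.ofReal_tsum]
  refine tsum_congr fun n => ?_
  rw [gt]; push_cast; ring

lemma S1_nonpos {r : ℝ} (h0 : 0 < r) (h1 : r < 1) :
    ∑' n : ℤ, (n : ℝ) ^ 1 * sS (r ^ 2) n * r ^ n ≤ 0 := by
  have hn := norm_r h0 h1
  have hs : Summable fun n : ℤ => (n : ℝ) ^ 1 * sS (r ^ 2) n * r ^ n := by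
    have := (summable_gt h0 h1 (dec_S h0) 1 hn.1 hn.2)
    refine Summable.of_norm (this.congr fun n => ?_)
    rw [gt, ← Complex.norm_real]; push_cast; ring_nf
  have e := (Equiv.neg ℤ).tsum_eq (fun n : ℤ => (n : ℝ) ^ 1 * sS (r ^ 2) n * r ^ n)
  have hs' := (Equiv.neg ℤ).summable_iff.2 hs
  have h2 := hs.tsum_add hs'
  simp only [Function.comp] at h2
  rw [e] at h2
  have h3 : ∑' n : ℤ, ((n : ℝ) ^ 1 * sS (r ^ 2) n * r ^ n +
      (((Equiv.neg ℤ) n : ℤ) : ℝ) ^ 1 * sS (r ^ 2) ((Equiv.neg ℤ) n) * r ^ ((Equiv.neg ℤ) n)) ≤ 0 := by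
    refine tsum_nonpos fun n => ?_
    rw [Equiv.neg_apply, sS_even]
    have hpos : 0 ≤ sS (r ^ 2) n := by
      rw [sS]; split_ifs
      · exact ee_nonneg (by positivity) n
      · exact le_rfl
    have : (n : ℝ) * (r ^ n - r ^ (-n)) ≤ 0 := by
      rcases le_total 0 n with h | h
      · have : r ^ n ≤ r ^ (-n) := (zpow_le_zpow_iff_right_of_lt_one₀ h0 h1).2 (by omega)
        have hn : (0:ℝ) ≤ n := by exact_mod_cast h
        nlinarith
      · have : r ^ (-n) ≤ r ^ n := (zpow_le_zpow_iff_right_of_lt_one₀ h0 h1).2 (by omega)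
        have hn : (n:ℝ) ≤ 0 := by exact_mod_cast h
        nlinarith
    push_cast
    nlinarith [mul_nonneg hpos (neg_nonneg.2 this)]
  linarith

lemma S1_eq {r : ℝ} (h0 : 0 < r) (h1 : r < 1) {t : ℂ} (ht : r ≤ ‖t‖) (ht' : ‖t‖ ≤ r⁻¹) :
    G (sS (r ^ 2)) 1 t = -2 * (G (sU (r ^ 2)) 0 t * G (sV (r ^ 2)) 0 t) :=
  conv1 h0 h1 (dec_U h0) (dec_V h0 h1) (conv_uv (pow_pos h0 2) (pow_pos_lt h0 h1 2 two_ne_zero).2) ht ht'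

lemma UV_r {r : ℝ} (h0 : 0 < r) (h1 : r < 1) :
    G (sU (r ^ 2)) 0 r * G (sV (r ^ 2)) 0 r =
      ((1/2 * ph ((r ^ 2) ^ 2) * ph (r ^ 2) * ph ((r ^ 2) ^ 4) * be (r ^ 2) : ℝ) : ℂ) := by
  have hq := pow_pos_lt h0 h1 2 two_ne_zero
  have hq2 := pow_pos_lt hq.1 hq.2 2 two_ne_zero
  have hq4 := pow_pos_lt hq.1 hq.2 4 (by norm_num)
  have hn := norm_r h0 h1
  have hu := G_U_sq h0 h1 hn.1 hn.2
  have hv := G_V_sq h0 h1 hn.1 hn.2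
  have hS : G (sS (r ^ 2)) 0 r = ((1/2 * ph ((r ^ 2) ^ 2) * ph (r ^ 2) : ℝ) : ℂ) := by
    rw [G_S h0 h1 hn.1 hn.2, ← Sxq hq.1 hq.2]; push_cast; rfl
  rw [hS] at hu hv
  have h1' := S1_eq h0 h1 hn.1 hn.2
  rw [G_real] at h1'
  set ρ := ∑' n : ℤ, (n : ℝ) ^ 1 * sS (r ^ 2) n * r ^ n with hρ
  have hρ0 : ρ ≤ 0 := S1_nonpos h0 h1
  have huv : G (sU (r ^ 2)) 0 r * G (sV (r ^ 2)) 0 r = ((-(1/2) * ρ : ℝ) : ℂ) := by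
    push_cast; linear_combination (1/2) * h1'
  rw [huv]
  congr 1
  obtain ⟨e1, e2, e3, e4⟩ := alg_rel hq.1 hq.2
  have hc := ph_pos hq2.1 hq2.2
  have hf := ph_pos hq.1 hq.2
  have ha := ph_pos hq4.1 hq4.2
  have hb := be_pos hq.1 hq.2
  have hsqC : ((-(1/2) * ρ : ℝ) : ℂ) ^ 2 =
      (((1/2 * ph ((r ^ 2) ^ 2) * ph (r ^ 2)) ^ 2 - 1/4 * pm ((r ^ 2) ^ 2) ^ 4) *
      ((1/2 * ph ((r ^ 2) ^ 2) * ph (r ^ 2)) ^ 2 - 1/4 * ph ((r ^ 2) ^ 2) ^ 4) : ℝ) := by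
    rw [← huv, mul_pow, hu, hv]; push_cast; ring
  have hsq : (-(1/2) * ρ) ^ 2 = ((1/2 * ph ((r ^ 2) ^ 2) * ph (r ^ 2)) ^ 2 - 1/4 * pm ((r ^ 2) ^ 2) ^ 4) *
      ((1/2 * ph ((r ^ 2) ^ 2) * ph (r ^ 2)) ^ 2 - 1/4 * ph ((r ^ 2) ^ 2) ^ 4) := by exact_mod_cast hsqC
  refine (sq_eq_sq₀ (by linarith) (by positivity)).1 ?_
  rw [hsq]
  set a := ph ((r ^ 2) ^ 4)
  set b := be (r ^ 2)
  set c := ph ((r ^ 2) ^ 2)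
  set d := pm ((r ^ 2) ^ 2)
  rw [e3, show d ^ 4 = (d ^ 2) ^ 2 by ring, show c ^ 4 = (c ^ 2) ^ 2 by ring, mul_pow, mul_pow, mul_pow, mul_pow,
    mul_pow, mul_pow, e1, e2]
  ring

lemma S3_value {q : ℝ} (h0 : 0 < q) (h1 : q < 1) :
    ∑' k : ℤ, (k : ℝ) ^ 3 * ee q (2 * k) * q ^ k =
      - (1/2 * ph (q ^ 2) * ph q * ph (q ^ 4) * be q) *
        (1/2 * ph (q ^ 4) * be q * (ph q ^ 2 + ph (q ^ 2) ^ 2) + ph (q ^ 2) ^ 2 * ph q ^ 2) := by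
  obtain ⟨r, hr0, hr1, rfl⟩ : ∃ r : ℝ, 0 < r ∧ r < 1 ∧ q = r ^ 2 :=
    ⟨√q, Real.sqrt_pos.2 h0, by rw [Real.sqrt_lt' one_pos]; simpa using h1, (Real.sq_sqrt h0.le).symm⟩
  have hn := norm_r hr0 hr1
  have hS : G (sS (r ^ 2)) 0 r = ((1/2 * ph ((r ^ 2) ^ 2) * ph (r ^ 2) : ℝ) : ℂ) := by
    rw [G_S hr0 hr1 hn.1 hn.2, ← Sxq h0 h1]; push_cast; rfl
  have h3 := S3_eq hr0 hr1 hn.1 hn.2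
  rw [UV_r hr0 hr1, G_U_sq hr0 hr1 hn.1 hn.2, G_V_sq hr0 hr1 hn.1 hn.2, hS] at h3
  have hG : G (sS (r ^ 2)) 3 r = ((8 * ∑' k : ℤ, (k : ℝ) ^ 3 * ee (r ^ 2) (2 * k) * (r ^ 2) ^ k : ℝ) : ℂ) := by
    have hs := (summable_gt hr0 hr1 (dec_S hr0) 3 hn.1 hn.2).of_norm
    have se := hs.comp_injective (i := fun k : ℤ => 2 * k) (fun x y h => by simpa using h)
    have := (hasSum_even_odd (f := gt (sS (r ^ 2)) 3 r) (b := 0) se.hasSum (by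
        refine hasSum_of_eq hasSum_zero (fun k => ?_) rfl
        simp [gt, sS])).tsum_eq
    rw [G, this, add_zero, ← tsum_mul_left, Complex.ofReal_tsum]
    refine tsum_congr fun k => ?_
    simp only [Function.comp, gt, sS, if_pos (even_2k k), zpow_mul (r : ℂ) 2 k]
    push_cast
    rw [show (r : ℂ) ^ (2 : ℤ) = (r : ℂ) ^ 2 by norm_cast]
    ring
  rw [hG] at h3
  obtain ⟨e1, e2, e3, e4⟩ := alg_rel h0 h1
  have h3' : 8 * ∑' k : ℤ, (k : ℝ) ^ 3 * ee (r ^ 2) (2 * k) * (r ^ 2) ^ k =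
      -8 * (1/2 * ph ((r ^ 2) ^ 2) * ph (r ^ 2) * ph ((r ^ 2) ^ 4) * be (r ^ 2)) *
      ((1/2 * ph ((r ^ 2) ^ 2) * ph (r ^ 2)) ^ 2 - 1/4 * pm ((r ^ 2) ^ 2) ^ 4
       + ((1/2 * ph ((r ^ 2) ^ 2) * ph (r ^ 2)) ^ 2 - 1/4 * ph ((r ^ 2) ^ 2) ^ 4)
       + 4 * (1/2 * ph ((r ^ 2) ^ 2) * ph (r ^ 2)) ^ 2) := by exact_mod_cast h3
  have h4 : (1/2 * ph ((r ^ 2) ^ 2) * ph (r ^ 2)) ^ 2 - 1/4 * pm ((r ^ 2) ^ 2) ^ 4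
       + ((1/2 * ph ((r ^ 2) ^ 2) * ph (r ^ 2)) ^ 2 - 1/4 * ph ((r ^ 2) ^ 2) ^ 4)
       + 4 * (1/2 * ph ((r ^ 2) ^ 2) * ph (r ^ 2)) ^ 2 =
       1/2 * ph ((r ^ 2) ^ 4) * be (r ^ 2) * (ph (r ^ 2) ^ 2 + ph ((r ^ 2) ^ 2) ^ 2)
        + ph ((r ^ 2) ^ 2) ^ 2 * ph (r ^ 2) ^ 2 := by
    set a := ph ((r ^ 2) ^ 4)
    set b := be (r ^ 2)
    set c := ph ((r ^ 2) ^ 2)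
    set d := pm ((r ^ 2) ^ 2)
    rw [e3, show d ^ 4 = (d ^ 2) ^ 2 by ring, show c ^ 4 = (c ^ 2) ^ 2 by ring, mul_pow, mul_pow, e1, e2]
    ring
  rw [h4] at h3'
  linarith

/-! ### Values at the eighth root of unity -/

/-- real valued character mod 8 -/
noncomputable def ch (n : ℕ) : ℝ := ((ZMod.χ₈ (n : ZMod 8) : ℤ) : ℝ)

lemma ch_add8 (n j : ℕ) : ch (n + 8 * j) = ch n := by
  have : ((n + 8 * j : ℕ) : ZMod 8) = n := by
    push_cast
    rw [show (8 : ZMod 8) = 0 from rfl]; ring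
  rw [ch, this, ch]

lemma abs_ch_le (n : ℕ) : |ch n| ≤ 1 := by
  have : ∀ x : ZMod 8, |ZMod.χ₈ x| ≤ 1 := by decide
  rw [ch]; exact_mod_cast this n

lemma ch_even {n : ℕ} (h : Even n) : ch n = 0 := by
  have hs : n % 8 < 8 := Nat.mod_lt _ (by norm_num)
  have hev : (n % 8) % 2 = 0 := by have := Nat.even_iff.1 h; omega
  rw [← Nat.mod_add_div n 8, ch_add8]
  generalize n % 8 = s at *
  interval_cases s <;> simp_all [ch]

lemma ze_pow8 : ze ^ 8 = 1 := by
  rw [show (8:ℕ) = 2 * 4 by norm_num, pow_mul, ze_sq]; simp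

lemma ze_add_inv : ze + ze⁻¹ = (√2 : ℝ) := by
  rw [ze_inv, ze, ← add_div, div_eq_iff sqrt2_ne, ← sq, sqrt2_sq]; ring

lemma ze_sub_inv : ze - ze⁻¹ = Complex.I * (√2 : ℝ) := by
  rw [ze_inv, ze, ← sub_div, div_eq_iff sqrt2_ne, mul_assoc, ← sq, sqrt2_sq]; ring

lemma ze_char {n : ℕ} (h : ¬ Even n) : ze ^ n + ze⁻¹ ^ n = (√2 : ℝ) * ch n := by
  have hs : n % 8 < 8 := Nat.mod_lt _ (by norm_num)
  have hev : (n % 8) % 2 = 1 := by have := Nat.not_even_iff.1 h; omega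
  have hi : ze⁻¹ ^ 8 = 1 := by rw [inv_pow, ze_pow8, inv_one]
  have hi2 : ze⁻¹ ^ 2 = -Complex.I := by rw [inv_pow, ze_sq, Complex.inv_I]
  have e1 := ze_add_inv
  have e2 := ze_sub_inv
  rw [← Nat.mod_add_div n 8, ch_add8, pow_add, pow_mul, ze_pow8, pow_add, pow_mul, hi, one_pow, mul_one, mul_one]
  have c1 : ch 1 = 1 := by rw [ch]; exact_mod_cast (by decide : ZMod.χ₈ ((1:ℕ) : ZMod 8) = 1)
  have c3 : ch 3 = -1 := by rw [ch]; exact_mod_cast (by decide : ZMod.χ₈ ((3:ℕ) : ZMod 8) = -1)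
  have c5 : ch 5 = -1 := by rw [ch]; exact_mod_cast (by decide : ZMod.χ₈ ((5:ℕ) : ZMod 8) = -1)
  have c7 : ch 7 = 1 := by rw [ch]; exact_mod_cast (by decide : ZMod.χ₈ ((7:ℕ) : ZMod 8) = 1)
  have p3 : ∀ x : ℂ, x ^ 3 = x ^ 2 * x := fun x => by ring
  have p5 : ∀ x : ℂ, x ^ 5 = (x ^ 2) ^ 2 * x := fun x => by ring
  have p7 : ∀ x : ℂ, x ^ 7 = (x ^ 2) ^ 3 * x := fun x => by ring
  have I2 := Complex.I_sq
  have I3 : Complex.I ^ 3 = - Complex.I := by rw [p3, I2]; ring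
  have h4 : n % 8 = 1 ∨ n % 8 = 3 ∨ n % 8 = 5 ∨ n % 8 = 7 := by omega
  rcases h4 with h | h | h | h <;> rw [h]
  · rw [c1]; push_cast; linear_combination e1
  · rw [c3, p3, p3, ze_sq, hi2]; push_cast; linear_combination Complex.I * e2 + (√2 : ℝ) * I2
  · rw [c5, p5, p5, ze_sq, hi2]; push_cast
    linear_combination -e1 + (ze + ze⁻¹) * I2
  · rw [c7, p7, p7, ze_sq, hi2]; push_cast
    linear_combination (ze - ze⁻¹) * I3 - Complex.I * e2 - (√2 : ℝ) * I2

lemma G_ze {r : ℝ} (h0 : 0 < r) (h1 : r < 1) {w : ℤ → ℝ} (hw : Dec r w) (k : ℕ)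
    (he : ∀ n : ℤ, Even n → w n = 0) (hs : ∀ n : ℤ, ((-n : ℤ) : ℝ) ^ k * w (-n) = (n : ℝ) ^ k * w n) :
    HasSum (fun n : ℕ => (((√2 : ℝ) * (ch n * ((n : ℝ) ^ k * w n)) : ℝ) : ℂ)) (G w k ze) := by
  have hn := norm_ok h0 h1 ze_norm
  have hsum := (summable_gt h0 h1 hw k hn.1 hn.2).of_norm
  have i1 : Function.Injective (fun n : ℕ => (n : ℤ)) := fun x y h => by simpa using h
  have i2 : Function.Injective (fun n : ℕ => -(n : ℤ)) := fun x y h => by simpa using h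
  have s1 := hsum.comp_injective i1
  have s2 := hsum.comp_injective i2
  have t := (HasSum.of_nat_of_neg (f := gt w k ze) s1.hasSum s2.hasSum).tsum_eq
  have z : gt w k ze 0 = 0 := by simp [gt, he 0 (by simp)]
  rw [z, sub_zero] at t
  rw [G, t]
  refine hasSum_of_eq (s1.hasSum.add s2.hasSum) (fun n => ?_) rfl
  simp only [Function.comp, gt]
  by_cases hev : Even n
  · have : Even (n : ℤ) := by exact_mod_cast hev
    rw [he n this, he (-n) (by simpa using this)]; simp
  · have := ze_char hev
    have hsC : ((-(n : ℤ) : ℤ) : ℂ) ^ k * w (-(n:ℤ)) = ((n : ℤ) : ℂ) ^ k * w n := by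
      have := hs n
      exact_mod_cast this
    rw [hsC, ← mul_add, zpow_neg, zpow_natCast, ← inv_pow, this]
    push_cast; ring

lemma U_even (q : ℝ) (n : ℤ) (h : Even n) : sU q n = 0 := by simp [sU, h]
lemma V_even (q : ℝ) (n : ℤ) (h : Even n) : sV q n = 0 := by simp [sV, h]

end Rep10

namespace Rep10
open Filter Topology

lemma Uz {r : ℝ} (h0 : 0 < r) (h1 : r < 1) (hr : r ^ 2 < 1/4) :
    G (sU (r ^ 2)) 0 ze = (((√2 : ℝ) * (1/2 * pm ((r ^ 2) ^ 2) * be (r ^ 2)) : ℝ) : ℂ) := by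
  have hq := pow_pos_lt h0 h1 2 two_ne_zero
  have hq2 := pow_pos_lt hq.1 hq.2 2 two_ne_zero
  have hn := norm_ok h0 h1 ze_norm
  have hg := G_ze h0 h1 (dec_U h0) 0 (U_even _) (fun n => by
    simp only [sU, even_neg, ee_even, pow_zero])
  have hsum := hg.summable
  rw [Complex.summable_ofReal] at hsum
  have hsq2 : (0:ℝ) < √2 := Real.sqrt_pos.2 two_pos
  set f := fun n : ℕ => ch n * ((n : ℝ) ^ 0 * sU (r ^ 2) n) with hf
  have hsf : Summable f := (summable_mul_left_iff hsq2.ne').1 hsum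
  have hG : G (sU (r ^ 2)) 0 ze = (((√2 : ℝ) * ∑' n, f n : ℝ) : ℂ) := by
    rw [← hg.tsum_eq, ← Complex.ofReal_tsum, tsum_mul_left]
  have hpos : 0 ≤ ∑' n, f n := by
    rw [← hsf.sum_add_tsum_nat_add 2]
    have c1 : ch 1 = 1 := by rw [ch]; exact_mod_cast (by decide : ZMod.χ₈ ((1:ℕ) : ZMod 8) = 1)
    have e0 : f 0 = 0 := by simp [hf, ch_even]
    have e1 : f 1 = r ^ 2 / (1 + (r ^ 2) ^ 2) := by
      simp only [hf, c1, sU, ee]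
      simp
      field_simp
      ring
    have htail : |∑' n, f (n + 2)| ≤ ∑' n : ℕ, (r ^ 2) ^ (n + 2) := by
      have hgeo : Summable fun n : ℕ => (r ^ 2) ^ (n + 2) :=
        (summable_nat_add_iff (f := fun n : ℕ => (r ^ 2) ^ n) 2).2 (summable_geometric_of_lt_one hq.1.le hq.2)
      have hb : ∀ n : ℕ, ‖f (n + 2)‖ ≤ (r ^ 2) ^ (n + 2) := by
        intro n
        rw [Real.norm_eq_abs]
        simp only [hf, pow_zero, one_mul, abs_mul]
        have a1 := abs_ch_le (n + 2)
        have a2 : |sU (r ^ 2) ((n + 2 : ℕ) : ℤ)| ≤ (r ^ 2) ^ (n + 2) := by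
          rw [sU]; split_ifs
          · simp; positivity
          · rw [abs_of_nonneg (ee_nonneg hq.1 _)]
            exact ee_nat_le hq.1 _
        calc _ ≤ 1 * (r ^ 2) ^ (n + 2) := by gcongr
          _ = _ := one_mul _
      exact tsum_of_norm_bounded hgeo.hasSum hb
    have hgs : ∑' n : ℕ, (r ^ 2) ^ (n + 2) = (r ^ 2) ^ 2 / (1 - r ^ 2) := by
      rw [tsum_congr (fun n => pow_add (r ^ 2) n 2), tsum_mul_right, tsum_geometric_of_lt_one hq.1.le hq.2]; ring
    rw [hgs] at htail
    have t1 := (abs_le.1 htail).1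
    rw [Finset.sum_range_succ, Finset.sum_range_succ, Finset.sum_range_zero, e0, e1]
    generalize r ^ 2 = q at *
    have : q ^ 2 / (1 - q) ≤ q / (1 + q ^ 2) := by
      rw [div_le_div_iff₀ (by linarith) (by positivity)]
      nlinarith [hq.1, mul_pos hq.1 hq.1, mul_pos hq.1 (mul_pos hq.1 hq.1)]
    linarith
  have hu := G_U_sq h0 h1 hn.1 hn.2
  rw [G_S h0 h1 hn.1 hn.2, ze_sq, SxI hq.1 hq.2, hG] at hu
  have hu' : (√2 * ∑' n, f n) ^ 2 = (1/2 * ph ((r ^ 2) ^ 2) * pm ((r ^ 2) ^ 2)) ^ 2 - 1/4 * pm ((r ^ 2) ^ 2) ^ 4 := by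
    exact_mod_cast hu
  rw [hG]
  congr 1
  have hd := pm_pos hq2.1 hq2.2
  have hb := be_pos hq.1 hq.2
  refine (sq_eq_sq₀ (by positivity) (by positivity)).1 ?_
  rw [hu']
  obtain ⟨e1, e2, e3, e4⟩ := alg_rel hq.1 hq.2
  have hs : √2 ^ 2 = 2 := Real.sq_sqrt (by norm_num)
  have hcd : ph ((r ^ 2) ^ 2) ^ 2 = pm ((r ^ 2) ^ 2) ^ 2 + 2 * be (r ^ 2) ^ 2 := by rw [e1, e2]; ring
  linear_combination (1/4) * pm ((r ^ 2) ^ 2) ^ 2 * hcd - (1/4) * pm ((r ^ 2) ^ 2) ^ 2 * be (r ^ 2) ^ 2 * hs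

lemma V3_value {q : ℝ} (h0 : 0 < q) (h1 : q < 1/4) :
    HasSum (fun n : ℕ => ch n * (n : ℝ) ^ 3 * hh q n)
      (-(1/2) * ph (q ^ 2) * be q * pm (q ^ 2) ^ 2 * (ph (q ^ 2) ^ 2 * pm (q ^ 2) ^ 2
        + 2 * be q ^ 2 * pm (q ^ 2) ^ 2 - 8 * be q ^ 2 * ph (q ^ 2) ^ 2)) := by
  obtain ⟨r, hr0, hr1, rfl⟩ : ∃ r : ℝ, 0 < r ∧ r < 1 ∧ q = r ^ 2 :=
    ⟨√q, Real.sqrt_pos.2 h0, by rw [Real.sqrt_lt' one_pos]; linarith, (Real.sq_sqrt h0.le).symm⟩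
  have hq := pow_pos_lt hr0 hr1 2 two_ne_zero
  have hn := norm_ok hr0 hr1 ze_norm
  have hg := G_ze hr0 hr1 (dec_V hr0 hr1) 3 (V_even _) (fun n => by
    rw [sV_odd]; push_cast; ring)
  have hv := V3_eq hr0 hr1 hn.1 hn.2
  rw [G_V_sq hr0 hr1 hn.1 hn.2, Uz hr0 hr1 h1, G_S hr0 hr1 hn.1 hn.2, ze_sq, SxI hq.1 hq.2] at hv
  rw [hv] at hg
  have hsq2 : (0:ℝ) < √2 := Real.sqrt_pos.2 two_pos
  set a := ph ((r ^ 2) ^ 4)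
  set b := be (r ^ 2)
  set c := ph ((r ^ 2) ^ 2)
  set d := pm ((r ^ 2) ^ 2)
  obtain ⟨e1, e2, e3, e4⟩ := alg_rel hq.1 hq.2
  have key : (-8 * ((1/2 * c * d) * (√2 * (1/2 * d * b))) * ((1/2 * c * d) ^ 2
      + (√2 * (1/2 * d * b)) ^ 2 + 4 * ((1/2 * c * d) ^ 2 - 1/4 * c ^ 4))) =
      √2 * (-(1/2) * c * b * d ^ 2 * (c ^ 2 * d ^ 2 + 2 * b ^ 2 * d ^ 2 - 8 * b ^ 2 * c ^ 2)) := by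
    have hs : √2 ^ 2 = 2 := Real.sq_sqrt (by norm_num)
    have hcd : c ^ 2 = d ^ 2 + 2 * b ^ 2 := by rw [e1, e2]; ring
    have : (1/2 * c * d) ^ 2 + (√2 * (1/2 * d * b)) ^ 2 + 4 * ((1/2 * c * d) ^ 2 - 1/4 * c ^ 4) =
      1/4 * (c ^ 2 * d ^ 2 + 2 * b ^ 2 * d ^ 2 - 8 * b ^ 2 * c ^ 2) := by
      rw [mul_pow √2, hs]
      linear_combination (-c ^ 2) * hcd
    rw [this]; ring
  have hg2 : HasSum (fun n : ℕ => (((√2 : ℝ) * (ch n * ((n : ℝ) ^ 3 * sV (r ^ 2) n)) : ℝ) : ℂ))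
      ((√2 * (-(1/2) * c * b * d ^ 2 * (c ^ 2 * d ^ 2 + 2 * b ^ 2 * d ^ 2 - 8 * b ^ 2 * c ^ 2)) : ℝ) : ℂ) := by
    rw [← key]
    refine hasSum_of_eq hg (fun k => rfl) ?_
    push_cast; ring
  rw [Complex.hasSum_ofReal] at hg2
  have hg3 := (hasSum_mul_left_iff hsq2.ne').1 hg2
  refine hasSum_of_eq hg3 (fun n => ?_) rfl
  by_cases h : Even n
  · simp [ch_even h]
  · have : ¬ Even (n : ℤ) := by exact_mod_cast h
    rw [sV, if_neg this]; ring

/-! ### Lambert series -/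

lemma lambert {q : ℝ} (h0 : 0 < q) (h1 : q < 1) {α γ g : ℕ → ℝ} (hα : ∀ d, |α d| ≤ (d : ℝ) ^ 3)
    (hγ : ∀ e, |γ e| ≤ 1) (hγ0 : γ 0 = 0)
    (hg : ∀ d, 0 < d → HasSum (fun e : ℕ => γ e * (q ^ d) ^ e) (g d)) :
    Summable (fun d : ℕ => α d * g d) ∧
    HasSum (fun n : ℕ => (∑ d ∈ n.divisors, α d * γ (n / d)) * q ^ n) (∑' d : ℕ, α d * g d) := by
  have hα0 : α 0 = 0 := by have := hα 0; simpa using this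
  set F : ℕ+ × ℕ+ → ℝ := fun c => α c.2 * γ c.1 * q ^ (c.1 * c.2 : ℕ) with hF
  have hs : Summable F := by
    have hm := summable_prod_mul_pow 3 (r := q) (by rw [Real.norm_of_nonneg h0.le]; exact h1)
    refine Summable.of_norm_bounded hm fun c => ?_
    rw [Real.norm_eq_abs, hF]
    simp only [abs_mul, abs_of_nonneg (pow_nonneg h0.le _)]
    gcongr
    calc |α c.2| * |γ c.1| ≤ ((c.2 : ℕ) : ℝ) ^ 3 * 1 := by gcongr; exacts [hα _, hγ _]
      _ = _ := by simp
  have hs' : Summable fun c : ℕ+ × ℕ+ => F (c.2, c.1) := hs.prod_symm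
  have hfib : ∀ d : ℕ+, HasSum (fun e : ℕ+ => F (e, d)) (α d * g d) := by
    intro d
    have := (hg d d.2).mul_left (α d)
    rw [← Function.Injective.hasSum_iff PNat.coe_injective] at this
    · refine hasSum_of_eq this (fun e => ?_) rfl
      simp only [hF, Function.comp]
      rw [mul_comm (e : ℕ), pow_mul]; ring
    · intro x hx
      have : x = 0 := by
        by_contra h
        exact hx ⟨⟨x, Nat.pos_of_ne_zero h⟩, rfl⟩
      rw [this, hγ0]; simp
  have hA := hs'.hasSum.prod_fiberwise hfib
  have hA' : HasSum (fun d : ℕ => α d * g d) (∑' c : ℕ+ × ℕ+, F (c.2, c.1)) := by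
    rw [← Function.Injective.hasSum_iff PNat.coe_injective]
    · exact hA
    · intro x hx
      have : x = 0 := by
        by_contra h
        exact hx ⟨⟨x, Nat.pos_of_ne_zero h⟩, rfl⟩
      rw [this, hα0]; simp
  refine ⟨hA'.summable, ?_⟩
  rw [hA'.tsum_eq]
  have hcomm : ∑' c : ℕ+ × ℕ+, F (c.2, c.1) = ∑' c : ℕ+ × ℕ+, F c :=
    (Equiv.prodComm ℕ+ ℕ+).tsum_eq F
  rw [hcomm]
  have hsig := (sigmaAntidiagonalEquivProd.hasSum_iff).2 hs.hasSum
  have hsg := hsig.sigma (g := fun n : ℕ+ => (∑ d ∈ (n : ℕ).divisors, α d * γ ((n : ℕ) / d)) * q ^ (n : ℕ)) (by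
    intro n
    have := hasSum_fintype (fun c : (n : ℕ).divisorsAntidiagonal => (F ∘ sigmaAntidiagonalEquivProd) ⟨n, c⟩)
    refine hasSum_of_eq this (fun k => rfl) ?_
    have e1 : ∀ c : (n : ℕ).divisorsAntidiagonal, (F ∘ sigmaAntidiagonalEquivProd) ⟨n, c⟩ =
        (fun x : ℕ × ℕ => α x.2 * γ x.1 * q ^ (x.1 * x.2)) c.1 := fun c => rfl
    simp_rw [e1]
    rw [Finset.univ_eq_attach, (n : ℕ).divisorsAntidiagonal.sum_attach (fun x : ℕ × ℕ => α x.2 * γ x.1 * q ^ (x.1 * x.2)),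
      Nat.sum_divisorsAntidiagonal' (fun x y => α y * γ x * q ^ (x * y)), Finset.sum_mul]
    refine Finset.sum_congr rfl fun i hi => ?_
    rw [Nat.div_mul_cancel (Nat.dvd_of_mem_divisors hi)])
  rw [← Function.Injective.hasSum_iff PNat.coe_injective]
  · exact hsg
  · intro x hx
    have : x = 0 := by
      by_contra h
      exact hx ⟨⟨x, Nat.pos_of_ne_zero h⟩, rfl⟩
    rw [this]; simp

lemma ch_series {x : ℝ} (h0 : 0 < x) (h1 : x < 1) :
    HasSum (fun m : ℕ => ch m * x ^ m) ((x - x ^ 3) / (1 + x ^ 4)) := by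
  have hs : Summable (fun m : ℕ => ch m * x ^ m) := by
    refine Summable.of_norm_bounded (summable_geometric_of_lt_one h0.le h1) fun m => ?_
    rw [norm_mul, Real.norm_eq_abs, Real.norm_of_nonneg (pow_nonneg h0.le _)]
    calc _ ≤ 1 * x ^ m := by gcongr; exact abs_ch_le m
      _ = _ := one_mul _
  have h := hs.sum_add_tsum_nat_add 8
  have hsh : ∀ m : ℕ, ch (m + 8) * x ^ (m + 8) = x ^ 8 * (ch m * x ^ m) := fun m => by
    rw [show ch (m + 8) = ch m from ch_add8 m 1]; ring
  simp_rw [hsh] at h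
  rw [tsum_mul_left] at h
  have c0 : ch 0 = 0 := ch_even (by decide)
  have c2 : ch 2 = 0 := ch_even (by decide)
  have c4 : ch 4 = 0 := ch_even (by decide)
  have c6 : ch 6 = 0 := ch_even (by decide)
  have c1 : ch 1 = 1 := by rw [ch]; exact_mod_cast (by decide : ZMod.χ₈ ((1:ℕ) : ZMod 8) = 1)
  have c3 : ch 3 = -1 := by rw [ch]; exact_mod_cast (by decide : ZMod.χ₈ ((3:ℕ) : ZMod 8) = -1)
  have c5 : ch 5 = -1 := by rw [ch]; exact_mod_cast (by decide : ZMod.χ₈ ((5:ℕ) : ZMod 8) = -1)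
  have c7 : ch 7 = 1 := by rw [ch]; exact_mod_cast (by decide : ZMod.χ₈ ((7:ℕ) : ZMod 8) = 1)
  simp only [Finset.sum_range_succ, Finset.sum_range_zero, c0, c1, c2, c3, c4, c5, c6, c7] at h
  have hx4 : x ^ 4 < 1 := pow_lt_one₀ h0.le h1 (by norm_num)
  have : ∑' m : ℕ, ch m * x ^ m = (x - x ^ 3) / (1 + x ^ 4) := by
    rw [eq_div_iff (by positivity)]
    have hne : 1 - x ^ 4 ≠ 0 := by linarith
    apply mul_right_cancel₀ hne
    linear_combination -h
  rw [← this]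
  exact hs.hasSum

end Rep10

namespace Rep10
open Filter Topology

lemma lim_pow {c : ℕ → ℝ} {R : ℝ} (hR : 0 < R) (hs : Summable fun n => c n * R ^ n) :
    Tendsto (fun y : ℝ => ∑' n, c n * y ^ n) (𝓝[>] 0) (𝓝 (c 0)) := by
  have hev : ∀ᶠ y : ℝ in 𝓝[>] 0, 0 < y ∧ y ≤ R := by
    filter_upwards [Ioo_mem_nhdsGT hR] with y hy
    exact ⟨hy.1, hy.2.le⟩
  have := tendsto_tsum_of_dominated_convergence (𝓕 := 𝓝[>] (0:ℝ)) (f := fun y n => c n * y ^ n)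
    (g := fun n => if n = 0 then c 0 else 0) hs.norm (by
      intro k
      have hc : Continuous fun y : ℝ => c k * y ^ k := by fun_prop
      have ht := tendsto_nhdsWithin_of_tendsto_nhds (s := Set.Ioi 0) (hc.tendsto 0)
      by_cases hk : k = 0
      · subst hk; simp
      · simpa [hk] using ht) (by
      filter_upwards [hev] with y hy k
      rw [norm_mul, norm_mul]
      gcongr
      rw [Real.norm_of_nonneg (pow_nonneg hy.1.le _), Real.norm_of_nonneg (pow_nonneg hR.le _)]
      exact pow_le_pow_left₀ hy.1.le hy.2 _)
  rwa [tsum_ite_eq] at this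

lemma coeff_unique {c : ℕ → ℝ} {R : ℝ} (hR : 0 < R)
    (h : ∀ q, 0 < q → q < R → HasSum (fun n => c n * q ^ n) 0) (n : ℕ) : c n = 0 := by
  induction n using Nat.strong_induction_on with
  | _ m ih =>
    have hsh : ∀ q, 0 < q → q < R → HasSum (fun n => c (n + m) * q ^ n) 0 := by
      intro q h0 h1
      have := (hasSum_nat_add_iff' m).2 (h q h0 h1)
      have hz : ∑ i ∈ Finset.range m, c i * q ^ i = 0 :=
        Finset.sum_eq_zero fun i hi => by rw [ih i (Finset.mem_range.1 hi), zero_mul]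
      rw [hz, sub_zero] at this
      have h2 := this.mul_right ((q ^ m)⁻¹)
      rw [zero_mul] at h2
      refine hasSum_of_eq h2 (fun k => ?_) rfl
      rw [pow_add]; field_simp
    have hl := lim_pow (c := fun n => c (n + m)) (R := R / 2) (by positivity)
      (hsh (R/2) (by positivity) (by linarith)).summable
    have hz : Tendsto (fun y : ℝ => ∑' n, c (n + m) * y ^ n) (𝓝[>] 0) (𝓝 0) := by
      refine tendsto_const_nhds.congr' ?_
      filter_upwards [Ioo_mem_nhdsGT hR] with y hy
      exact (hsh y hy.1 hy.2).tsum_eq.symm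
    simpa using tendsto_nhds_unique hl hz

lemma A_value {q : ℝ} (h0 : 0 < q) (h1 : q < 1) :
    HasSum (fun n : ℕ => (sigmaChi8One n : ℝ) * q ^ n)
      ((1/2 * ph (q ^ 2) * ph q * ph (q ^ 4) * be q) *
        (1/2 * ph (q ^ 4) * be q * (ph q ^ 2 + ph (q ^ 2) ^ 2) + ph (q ^ 2) ^ 2 * ph q ^ 2)) := by
  set g : ℕ → ℝ := fun d => (q ^ d - (q ^ d) ^ 3) / (1 + (q ^ d) ^ 4) with hg
  have L := lambert h0 h1 (α := fun d => (d : ℝ) ^ 3) (γ := ch) (g := g)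
    (fun d => by rw [abs_of_nonneg (by positivity)]) abs_ch_le (ch_even (by decide)) (fun d hd => by
      have := pow_pos_lt h0 h1 d hd.ne'
      exact ch_series this.1 this.2)
  have hS := S3_value h0 h1
  have b0 : Summable fun n : ℕ => (n : ℝ) ^ 3 * q ^ n :=
    summable_pow_mul_geometric_of_norm_lt_one 3 (by rw [Real.norm_of_nonneg h0.le]; exact h1)
  have hee : ∀ n : ℕ, ee q (2 * n) ≤ (q ^ n) ^ 2 := fun n => by
    have := ee_nat_le h0 (2 * n)
    rw [← pow_mul, mul_comm n 2]
    exact_mod_cast this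
  have hqn : ∀ n : ℕ, 0 < q ^ n ∧ q ^ n ≤ 1 := fun n => ⟨by positivity, pow_le_one₀ h0.le h1.le⟩
  set f : ℤ → ℝ := fun k => (k : ℝ) ^ 3 * ee q (2 * k) * q ^ k with hf
  have s1 : Summable fun n : ℕ => f n := by
    refine Summable.of_norm_bounded b0 fun n => ?_
    have h2 := hee n
    have h3 := ee_nonneg h0 (2 * n)
    have h4 := hqn n
    simp only [hf, Int.cast_natCast, zpow_natCast]
    rw [Real.norm_of_nonneg (by positivity), mul_assoc]
    gcongr
    have : ee q (2 * n) ≤ 1 := h2.trans (by nlinarith)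
    nlinarith
  have s2 : Summable fun n : ℕ => f (-n) := by
    refine Summable.of_norm_bounded b0 fun n => ?_
    have h2 := hee n
    have h3 := ee_nonneg h0 (2 * n)
    have h4 := hqn n
    have e : f (-n) = - ((n : ℝ) ^ 3 * (ee q (2 * n) * (q ^ n)⁻¹)) := by
      simp only [hf, mul_neg, ee_even, zpow_neg, zpow_natCast]
      push_cast; ring
    rw [e, norm_neg, Real.norm_of_nonneg (by positivity)]
    gcongr
    rw [← div_eq_mul_inv, div_le_iff₀ h4.1]
    linarith [sq (q ^ n)]
  have tot := (HasSum.of_nat_of_neg (f := f) s1.hasSum s2.hasSum).tsum_eq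
  have f0 : f 0 = 0 := by simp [hf]
  rw [f0, sub_zero, ← s1.tsum_add s2] at tot
  have hneg : ∑' n : ℕ, (f n + f (-n)) = - ∑' d : ℕ, (d : ℝ) ^ 3 * g d := by
    rw [← tsum_neg]
    refine tsum_congr fun n => ?_
    have h4 := hqn n
    have he : ee q (2 * n) = ((q ^ n) ^ 2 + ((q ^ n) ^ 2)⁻¹)⁻¹ := by
      rw [ee, zpow_neg, show (2 * (n:ℤ)) = ((n * 2 : ℕ) : ℤ) by push_cast; ring, zpow_natCast, pow_mul]
    simp only [hf, mul_neg, ee_even, zpow_neg, zpow_natCast, hg, he]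
    push_cast
    generalize q ^ n = x at h4
    have hx := h4.1
    field_simp
    ring
  rw [hneg, hS] at tot
  refine hasSum_of_eq L.2 (fun n => ?_) (by linarith)
  congr 1
  rw [sigmaChi8One]
  push_cast
  refine Finset.sum_congr rfl fun d _ => ?_
  rw [ch]; ring

noncomputable def Bs (q : ℝ) : ℝ := ∑' d : ℕ, ch d * (d : ℝ) ^ 3 * (q ^ d / (1 - q ^ d))

lemma B_lambert {q : ℝ} (h0 : 0 < q) (h1 : q < 1) :
    Summable (fun d : ℕ => ch d * (d : ℝ) ^ 3 * (q ^ d / (1 - q ^ d))) ∧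
    HasSum (fun n : ℕ => (sigmaOneChi8 n : ℝ) * q ^ n) (Bs q) := by
  have L := lambert h0 h1 (α := fun d => ch d * (d : ℝ) ^ 3) (γ := fun e => if e = 0 then 0 else 1)
    (g := fun d => q ^ d / (1 - q ^ d))
    (fun d => by
      rw [abs_mul, abs_of_nonneg (a := (d : ℝ) ^ 3) (by positivity)]
      calc _ ≤ 1 * (d : ℝ) ^ 3 := by gcongr; exact abs_ch_le d
        _ = _ := one_mul _)
    (fun e => by split_ifs <;> simp) (by simp) (fun d hd => by
      have hx := pow_pos_lt h0 h1 d hd.ne'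
      have := hasSum_geometric_of_lt_one hx.1.le hx.2
      have h2 := (hasSum_nat_add_iff' 1).2 this
      refine (hasSum_nat_add_iff' 1).1 ?_
      have h3 : 1 - q ^ d ≠ 0 := by linarith
      refine hasSum_of_eq h2 (fun n => by simp) ?_
      simp
      field_simp
      ring)
  refine ⟨L.1, ?_⟩
  refine hasSum_of_eq L.2 (fun n => ?_) rfl
  congr 1
  rw [sigmaOneChi8]
  push_cast
  refine Finset.sum_congr rfl fun d hd => ?_
  have : n / d ≠ 0 := by
    have h1 := Nat.dvd_of_mem_divisors hd
    have h2 := Nat.pos_of_mem_divisors hd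
    have h3 : n ≠ 0 := (Nat.mem_divisors.1 hd).2
    exact (Nat.div_pos (Nat.le_of_dvd (Nat.pos_of_ne_zero h3) h1) h2).ne'
  rw [ch, if_neg this]; ring

lemma Bs_rec {q : ℝ} (h0 : 0 < q) (h1 : q < 1/4) : Bs q - Bs (q ^ 2) =
    1/2 * ph (q ^ 2) * be q * pm (q ^ 2) ^ 2 * (ph (q ^ 2) ^ 2 * pm (q ^ 2) ^ 2
        + 2 * be q ^ 2 * pm (q ^ 2) ^ 2 - 8 * be q ^ 2 * ph (q ^ 2) ^ 2) := by
  have h1' : q < 1 := by linarith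
  have hq2 := pow_pos_lt h0 h1' 2 two_ne_zero
  have s1 := (B_lambert h0 h1').1
  have s2 := (B_lambert hq2.1 hq2.2).1
  rw [Bs, Bs, ← s1.tsum_sub s2]
  have hv := (V3_value h0 h1).tsum_eq
  have : ∑' d : ℕ, (ch d * (d : ℝ) ^ 3 * (q ^ d / (1 - q ^ d)) -
      ch d * (d : ℝ) ^ 3 * ((q ^ 2) ^ d / (1 - (q ^ 2) ^ d))) = - ∑' n : ℕ, ch n * (n : ℝ) ^ 3 * hh q n := by
    rw [← tsum_neg]
    refine tsum_congr fun d => ?_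
    rcases Nat.eq_zero_or_pos d with rfl | hd
    · simp
    have hx := pow_pos_lt h0 h1' d hd.ne'
    rw [hh, zpow_neg, zpow_natCast, ← pow_mul, mul_comm 2 d, pow_mul]
    generalize q ^ d = x at hx
    have a1 : 1 - x ≠ 0 := by linarith
    have a2 : 1 - x ^ 2 ≠ 0 := by nlinarith [hx.1, hx.2]
    have a3 : x ≠ 0 := hx.1.ne'
    have a4 : x - x⁻¹ ≠ 0 := by
      intro h
      apply a2
      field_simp at h
      linarith
    have e : (x - x⁻¹)⁻¹ = - (x / (1 - x ^ 2)) := by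
      refine inv_eq_of_mul_eq_one_right ?_
      field_simp
      ring
    rw [e]
    have e2 : x / (1 - x) = x * (1 + x) / (1 - x ^ 2) := by
      rw [div_eq_div_iff a1 a2]; ring
    rw [e2]; ring
  rw [this, hv]; ring

lemma B_value {q : ℝ} (h0 : 0 < q) (h1 : q < 1/4) : 1 + 2/11 * Bs q =
    ph (q ^ 2) * ph q * pm q ^ 2 * (pm q ^ 4 + 6 * ph q ^ 2 * pm q ^ 2 + 4 * ph q ^ 4) / 11 := by
  set be' : ℝ → ℝ := fun q =>
    ph (q ^ 2) * ph q * pm q ^ 2 * (pm q ^ 4 + 6 * ph q ^ 2 * pm q ^ 2 + 4 * ph q ^ 4) / 11 with hb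
  have key := rec_lim (M := fun q => 1 + 2/11 * Bs q - be' q) (L := 0) (R := 1/4) (by norm_num) (by
    intro q h0 h1
    have h1' : q < 1 := by linarith
    have hr := Bs_rec h0 h1
    obtain ⟨e1, e2, e3, e4⟩ := alg_rel h0 h1'
    simp only [hb]
    rw [show (q ^ 2) ^ 2 = q ^ 4 by ring]
    have p : ∀ x : ℝ, x ^ 4 = (x ^ 2) ^ 2 := fun x => by ring
    rw [p (pm (q ^ 2)), p (ph (q ^ 2)), e1, e2, e3, e4]
    rw [e1, e2] at hr
    linear_combination (2/11) * hr) (by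
    have t1 : Tendsto Bs (𝓝[>] 0) (𝓝 0) := by
      have := lim_pow (R := 1/2) (by norm_num) (B_lambert (q := 1/2) (by norm_num) (by norm_num)).2.summable
      have hz : (sigmaOneChi8 0 : ℝ) = 0 := by simp [sigmaOneChi8]
      rw [hz] at this
      refine this.congr' ?_
      filter_upwards [Ioo_mem_nhdsGT (zero_lt_one' ℝ)] with y hy
      exact (B_lambert hy.1 hy.2).2.tsum_eq
    have t2 : Tendsto (fun q => ph (q ^ 2)) (𝓝[>] 0) (𝓝 1) := lim_ph.comp tendsto_sq
    have t3 := ((t2.mul lim_ph).mul (lim_pm.pow 2)).mul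
      (((lim_pm.pow 4).add (((lim_ph.pow 2).const_mul 6).mul (lim_pm.pow 2))).add ((lim_ph.pow 4).const_mul 4))
    have t4 := ((t1.const_mul (2/11)).const_add 1).sub (t3.div_const 11)
    norm_num at t4
    refine t4.congr fun q => ?_
    simp only [hb]) h0 h1
  exact sub_eq_zero.1 key

end Rep10

namespace Rep10
open Filter Topology

lemma eta_val {q : ℝ} (h0 : 0 < q) (h1 : q < 1) {z : ℂ}
    (hz : Complex.exp (2 * Real.pi * Complex.I * z) = q) (k : ℕ) (hk : k ≠ 0) :
    dedekindEta (k * z) = Complex.exp (Real.pi * Complex.I * z / 12) ^ k * (E (q ^ k) : ℂ) := by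
  have hx := pow_pos_lt h0 h1 k hk
  rw [dedekindEta, E]
  congr 1
  · rw [← Complex.exp_nat_mul]; congr 1; ring
  · have := (multipliable_E hx.1 hx.2).map_tprod Complex.ofRealHom Complex.continuous_ofReal
    have h2 : ((∏' m : ℕ, (1 - (q ^ k) ^ (m + 1)) : ℝ) : ℂ) = ∏' m : ℕ, Complex.ofRealHom (1 - (q ^ k) ^ (m + 1)) := this
    rw [h2]
    refine tprod_congr fun m => ?_
    have e : Complex.exp (2 * Real.pi * Complex.I * (m + 1) * (k * z)) = (q : ℂ) ^ (k * (m + 1)) := by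
      rw [← hz, ← Complex.exp_nat_mul]; congr 1; push_cast; ring
    rw [e]
    simp [pow_mul]

lemma exists_z {q : ℝ} (h0 : 0 < q) (h1 : q < 1) : ∃ z : ℂ, 0 < z.im ∧
    Complex.exp (2 * Real.pi * Complex.I * z) = q := by
  refine ⟨Complex.I * ((-Real.log q / (2 * Real.pi) : ℝ) : ℂ), ?_, ?_⟩
  · have := Real.log_neg h0 h1
    have hp := Real.pi_pos
    rw [Complex.I_mul_im, Complex.ofReal_re]
    apply div_pos <;> linarith
  · have : (2 * Real.pi * Complex.I * (Complex.I * ((-Real.log q / (2 * Real.pi) : ℝ) : ℂ))) = (Real.log q : ℂ) := by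
      have hp : (Real.pi : ℂ) ≠ 0 := by exact_mod_cast Real.pi_ne_zero
      push_cast
      field_simp
      rw [Complex.I_sq]; ring
    rw [this, ← Complex.ofReal_exp, Real.exp_log h0]

lemma hasSum_of_tsum_real {a : ℕ → ℤ} {q v : ℝ} (hv : v ≠ 0)
    (h : (v : ℂ) = ∑' m : ℕ, (a (m + 1) : ℂ) * (q : ℂ) ^ (m + 1)) :
    HasSum (fun m : ℕ => (a (m + 1) : ℝ) * q ^ (m + 1)) v := by
  have h' : v = ∑' m : ℕ, (a (m + 1) : ℝ) * q ^ (m + 1) := by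
    have : ∑' m : ℕ, (a (m + 1) : ℂ) * (q : ℂ) ^ (m + 1) =
      ((∑' m : ℕ, (a (m + 1) : ℝ) * q ^ (m + 1) : ℝ) : ℂ) := by
      rw [Complex.ofReal_tsum]; push_cast; rfl
    rw [this] at h
    exact_mod_cast h
  have hs : Summable (fun m : ℕ => (a (m + 1) : ℝ) * q ^ (m + 1)) := by
    by_contra hn
    rw [tsum_eq_zero_of_not_summable hn] at h'
    exact hv h'
  rw [h']; exact hs.hasSum

lemma a1_value {a1 : ℕ → ℤ} (ha1 : ∀ z : ℂ, 0 < z.im →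
      dedekindEta z ^ (-2 : ℤ) * dedekindEta (2 * z) ^ (11 : ℤ) * dedekindEta (4 * z) ^ (-3 : ℤ) * dedekindEta (8 * z) ^ (2 : ℤ)
        = ∑' m : ℕ, (a1 (m + 1) : ℂ) * Complex.exp (2 * Real.pi * Complex.I * z) ^ (m + 1))
    {q : ℝ} (h0 : 0 < q) (h1 : q < 1) :
    HasSum (fun m : ℕ => (a1 (m + 1) : ℝ) * q ^ (m + 1))
      (1/2 * ph (q ^ 4) * be q * ph q * pm (q ^ 2) ^ 4 * ph (q ^ 2)) := by
  obtain ⟨z, hz, hqz⟩ := exists_z h0 h1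
  have h := ha1 z hz
  have n1 := eta_val h0 h1 hqz 1 (by norm_num)
  have n2 := eta_val h0 h1 hqz 2 (by norm_num)
  have n4 := eta_val h0 h1 hqz 4 (by norm_num)
  have n8 := eta_val h0 h1 hqz 8 (by norm_num)
  simp only [Nat.cast_one, one_mul, pow_one, Nat.cast_ofNat] at n1 n2 n4 n8
  have hq2 := pow_pos_lt h0 h1 2 (by norm_num)
  have hq4 := pow_pos_lt h0 h1 4 (by norm_num)
  have hq8 := pow_pos_lt h0 h1 8 (by norm_num)
  have hq16 := pow_pos_lt h0 h1 16 (by norm_num)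
  have E1 := E_pos h0 h1
  have E2 := E_pos hq2.1 hq2.2
  have E4 := E_pos hq4.1 hq4.2
  have E8 := E_pos hq8.1 hq8.2
  have E16 := E_pos hq16.1 hq16.2
  have hval : 1/2 * ph (q ^ 4) * be q * ph q * pm (q ^ 2) ^ 4 * ph (q ^ 2) =
      q * (E (q ^ 2) ^ 11 * E (q ^ 8) ^ 2 / (E q ^ 2 * E (q ^ 4) ^ 3)) := by
    rw [ph_eq hq4.1 hq4.2, be_eq h0 h1, ph_eq h0 h1, pm_eq hq2.1 hq2.2, ph_eq hq2.1 hq2.2]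
    simp only [← pow_mul]
    norm_num only
    field_simp
  rw [hval]
  refine hasSum_of_tsum_real (by positivity) ?_
  rw [hqz] at h
  rw [← h, n1, n2, n4, n8]
  set w := Complex.exp (Real.pi * Complex.I * z / 12) with hw
  have hw0 : w ≠ 0 := Complex.exp_ne_zero _
  have hwq : w ^ 24 = q := by
    rw [← hqz, hw, ← Complex.exp_nat_mul]; congr 1; push_cast; ring
  have c1 : (E q : ℂ) ≠ 0 := by exact_mod_cast E1.ne'
  have c4 : (E (q ^ 4) : ℂ) ≠ 0 := by exact_mod_cast E4.ne'
  push_cast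
  rw [← hwq]
  rw [zpow_neg, zpow_neg, zpow_ofNat, zpow_ofNat, zpow_ofNat, zpow_ofNat]
  field_simp

lemma a2_value {a2 : ℕ → ℤ} (ha2 : ∀ z : ℂ, 0 < z.im →
      dedekindEta z ^ (2 : ℤ) * dedekindEta (2 * z) ^ (-3 : ℤ) * dedekindEta (4 * z) ^ (11 : ℤ) * dedekindEta (8 * z) ^ (-2 : ℤ)
        = ∑' m : ℕ, (a2 (m + 1) : ℂ) * Complex.exp (2 * Real.pi * Complex.I * z) ^ (m + 1))
    {q : ℝ} (h0 : 0 < q) (h1 : q < 1) :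
    HasSum (fun m : ℕ => (a2 (m + 1) : ℝ) * q ^ (m + 1))
      (1/2 * ph (q ^ 4) * be q * pm q * pm (q ^ 2) ^ 2 * ph (q ^ 2) ^ 3) := by
  obtain ⟨z, hz, hqz⟩ := exists_z h0 h1
  have h := ha2 z hz
  have n1 := eta_val h0 h1 hqz 1 (by norm_num)
  have n2 := eta_val h0 h1 hqz 2 (by norm_num)
  have n4 := eta_val h0 h1 hqz 4 (by norm_num)
  have n8 := eta_val h0 h1 hqz 8 (by norm_num)
  simp only [Nat.cast_one, one_mul, pow_one, Nat.cast_ofNat] at n1 n2 n4 n8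
  have hq2 := pow_pos_lt h0 h1 2 (by norm_num)
  have hq4 := pow_pos_lt h0 h1 4 (by norm_num)
  have hq8 := pow_pos_lt h0 h1 8 (by norm_num)
  have hq16 := pow_pos_lt h0 h1 16 (by norm_num)
  have E1 := E_pos h0 h1
  have E2 := E_pos hq2.1 hq2.2
  have E4 := E_pos hq4.1 hq4.2
  have E8 := E_pos hq8.1 hq8.2
  have E16 := E_pos hq16.1 hq16.2
  have hval : 1/2 * ph (q ^ 4) * be q * pm q * pm (q ^ 2) ^ 2 * ph (q ^ 2) ^ 3 =
      q * (E q ^ 2 * E (q ^ 4) ^ 11 / (E (q ^ 2) ^ 3 * E (q ^ 8) ^ 2)) := by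
    rw [ph_eq hq4.1 hq4.2, be_eq h0 h1, pm_eq h0 h1, pm_eq hq2.1 hq2.2, ph_eq hq2.1 hq2.2]
    simp only [← pow_mul]
    norm_num only
    field_simp
  rw [hval]
  refine hasSum_of_tsum_real (by positivity) ?_
  rw [hqz] at h
  rw [← h, n1, n2, n4, n8]
  set w := Complex.exp (Real.pi * Complex.I * z / 12) with hw
  have hw0 : w ≠ 0 := Complex.exp_ne_zero _
  have hwq : w ^ 24 = q := by
    rw [← hqz, hw, ← Complex.exp_nat_mul]; congr 1; push_cast; ring
  have c1 : (E (q ^ 2) : ℂ) ≠ 0 := by exact_mod_cast E2.ne'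
  have c4 : (E (q ^ 8) : ℂ) ≠ 0 := by exact_mod_cast E8.ne'
  push_cast
  rw [← hwq]
  rw [zpow_neg, zpow_neg, zpow_ofNat, zpow_ofNat, zpow_ofNat, zpow_ofNat]
  field_simp

end Rep10

namespace Rep10
open Filter Topology

lemma hasSum_pi {q : ℝ} : ∀ (n : ℕ) (F : Fin n → ℤ → ℝ) (v : Fin n → ℝ), (∀ i k, 0 ≤ F i k) →
    (∀ i, HasSum (F i) (v i)) → HasSum (fun x : Fin n → ℤ => ∏ i, F i (x i)) (∏ i, v i) := by
  intro n
  induction n with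
  | zero =>
    intro F v _ _
    have := hasSum_fintype (fun x : Fin 0 → ℤ => ∏ i, F i (x i))
    simpa using this
  | succ n ih =>
    intro F v h0 hF
    have h2 := ih (fun i => F i.succ) (fun i => v i.succ) (fun i k => h0 _ _) (fun i => hF _)
    have hs := (hF 0).summable.mul_of_nonneg h2.summable (fun k => h0 0 k)
      (fun x => Finset.prod_nonneg fun i _ => h0 _ _)
    have h3 := (hF 0).mul h2 hs
    rw [← (Fin.consEquiv (fun _ : Fin (n + 1) => ℤ)).hasSum_iff]
    refine hasSum_of_eq h3 (fun k => ?_) (Fin.prod_univ_succ _)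
    simp [Fin.consEquiv, Fin.prod_univ_succ]

lemma rep_series {q : ℝ} (h0 : 0 < q) (h1 : q < 1) :
    HasSum (fun n : ℕ => (repCount ![1, 1, 1, 1, 1, 2, 4, 4] n : ℝ) * q ^ n)
      (ph q ^ 5 * ph (q ^ 2) * ph (q ^ 4) ^ 2) := by
  set a : Fin 8 → ℕ := ![1, 1, 1, 1, 1, 2, 4, 4] with ha
  have hapos : ∀ i, a i ≠ 0 := by intro i; fin_cases i <;> simp [ha]
  have hp := hasSum_pi (q := q) 8 (fun i k => (q ^ a i) ^ (k ^ 2)) (fun i => ph (q ^ a i))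
    (fun i k => by positivity) (fun i => by
      have := pow_pos_lt h0 h1 (a i) (hapos i)
      exact (summable_ph this.1 this.2).hasSum)
  have hv : ∏ i, ph (q ^ a i) = ph q ^ 5 * ph (q ^ 2) * ph (q ^ 4) ^ 2 := by
    simp [Fin.prod_univ_succ, ha]; ring
  rw [hv] at hp
  set N : (Fin 8 → ℤ) → ℕ := fun x => ∑ i, a i * (x i).natAbs ^ 2 with hN
  have hq : ∀ x : Fin 8 → ℤ, ∏ i, (q ^ a i) ^ (x i ^ 2) = q ^ N x := by
    intro x
    rw [hN, ← Finset.prod_pow_eq_pow_sum]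
    refine Finset.prod_congr rfl fun i _ => ?_
    rw [← Int.natAbs_sq, ← Nat.cast_pow, zpow_natCast, ← pow_mul]
  simp_rw [hq] at hp
  have hf := hp.tsum_fiberwise N
  refine hasSum_of_eq hf (fun n => ?_) rfl
  have e : ∀ x : N ⁻¹' {n}, q ^ N x = q ^ n := fun x => by
    have : N x = n := x.2
    rw [this]
  rw [tsum_congr e, tsum_const, nsmul_eq_mul]
  congr 2
  rw [repCount]
  refine Nat.card_congr (Equiv.subtypeEquivRight fun x => ?_)
  rw [Set.mem_preimage, Set.mem_singleton_iff, ← Nat.cast_inj (R := ℤ), hN]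
  push_cast
  simp only [sq_abs]

lemma half_series {f : ℕ → ℤ} {q v : ℝ}
    (h : HasSum (fun m : ℕ => (f (m + 1) : ℝ) * (q ^ 2) ^ (m + 1)) v) :
    HasSum (fun n : ℕ => (half f (n + 1) : ℝ) * q ^ (n + 1)) v := by
  have hi : Function.Injective (fun m : ℕ => 2 * m + 1) := fun x y h => by simpa using h
  rw [← hi.hasSum_iff]
  · refine hasSum_of_eq h (fun m => ?_) rfl
    have h1 : (2 * m + 1 + 1) / 2 = m + 1 := by omega
    have h2 : 2 ∣ 2 * m + 1 + 1 := by omega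
    simp only [Function.comp, half, if_pos h2, h1]
    rw [← pow_mul, mul_add, mul_one]
    push_cast; rfl
  · intro n hn
    have : ¬ 2 ∣ n + 1 := fun h => hn ⟨n / 2, by simp only; omega⟩
    simp [half, this]

lemma shift_one {f : ℕ → ℝ} {q v : ℝ} (h : HasSum (fun n => f n * q ^ n) v) :
    HasSum (fun n => f (n + 1) * q ^ (n + 1)) (v - f 0) := by
  have := (hasSum_nat_add_iff' 1).2 h
  simpa using this

lemma final_identity {q : ℝ} (h0 : 0 < q) (h1 : q < 1/4) :
    ph q ^ 5 * ph (q ^ 2) * ph (q ^ 4) ^ 2 = 1 +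
      (32/11 * ((1/2 * ph (q ^ 2) * ph q * ph (q ^ 4) * be q) *
        (1/2 * ph (q ^ 4) * be q * (ph q ^ 2 + ph (q ^ 2) ^ 2) + ph (q ^ 2) ^ 2 * ph q ^ 2))
      + 2/11 * Bs (q ^ 2)
      + -14/11 * (1/2 * ph (q ^ 4) * be q * ph q * pm (q ^ 2) ^ 4 * ph (q ^ 2))
      + 92/11 * (1/2 * ph (q ^ 4) * be q * pm q * pm (q ^ 2) ^ 2 * ph (q ^ 2) ^ 3)
      + 224/11 * (1/2 * ph ((q ^ 2) ^ 4) * be (q ^ 2) * ph (q ^ 2) * pm ((q ^ 2) ^ 2) ^ 4 * ph ((q ^ 2) ^ 2))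
      + 192/11 * (1/2 * ph ((q ^ 2) ^ 4) * be (q ^ 2) * pm (q ^ 2) * pm ((q ^ 2) ^ 2) ^ 2 * ph ((q ^ 2) ^ 2) ^ 3)) := by
  have h1' : q < 1 := by linarith
  have hq := pow_pos_lt h0 h1' 2 two_ne_zero
  have hB := B_value hq.1 (show q ^ 2 < 1/4 by nlinarith)
  obtain ⟨e1, e2, e3, e4⟩ := alg_rel h0 h1'
  obtain ⟨g1, g2, g3, g4⟩ := alg_rel hq.1 hq.2
  have hB' := eq_sub_of_add_eq' hB
  rw [hB']
  rw [show (q ^ 2) ^ 2 = q ^ 4 by ring] at *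
  set a := ph (q ^ 4)
  set b := be q
  set c := ph (q ^ 2)
  set d := pm (q ^ 2)
  set a' := ph ((q ^ 2) ^ 4)
  set b' := be (q ^ 2)
  have hab : a' * b' = b ^ 2 / 2 := by
    have : 4 * (a' * b') = c ^ 2 - d ^ 2 := by rw [g3, g4]; ring
    rw [e1, e2] at this; linarith
  have hm : pm (q ^ 4) ^ 2 = c * d := by rw [g2, g3, g4]; ring
  have t1 : 1/2 * a' * b' * c * pm (q ^ 4) ^ 4 * a = c * (1/4 * b ^ 2 * (a ^ 2 + b ^ 2) * (a ^ 2 - b ^ 2) * a) := by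
    rw [show pm (q ^ 4) ^ 4 = (pm (q ^ 4) ^ 2) ^ 2 by ring, hm, ← e1, ← e2]
    linear_combination (1/2 * c ^ 3 * d ^ 2 * a) * hab
  have t2 : 1/2 * a' * b' * d * pm (q ^ 4) ^ 2 * a ^ 3 = c * (1/4 * b ^ 2 * (a ^ 2 - b ^ 2) * a ^ 3) := by
    rw [hm, ← e2]
    linear_combination (1/2 * c * d ^ 2 * a ^ 3) * hab
  rw [t1, t2, e3, e4, show d ^ 4 = (d ^ 2) ^ 2 by ring, show c ^ 4 = (c ^ 2) ^ 2 by ring,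
    show c ^ 3 = c * c ^ 2 by ring, e1, e2]
  ring

end Rep10

theorem representation_formula_10
    (a1 a2 : ℕ → ℤ)
    (ha1 : ∀ z : ℂ, 0 < z.im →
      dedekindEta z ^ (-2 : ℤ) * dedekindEta (2 * z) ^ (11 : ℤ) * dedekindEta (4 * z) ^ (-3 : ℤ) * dedekindEta (8 * z) ^ (2 : ℤ)
        = ∑' m : ℕ, (a1 (m + 1) : ℂ) * Complex.exp (2 * Real.pi * Complex.I * z) ^ (m + 1))
    (ha2 : ∀ z : ℂ, 0 < z.im →
      dedekindEta z ^ (2 : ℤ) * dedekindEta (2 * z) ^ (-3 : ℤ) * dedekindEta (4 * z) ^ (11 : ℤ) * dedekindEta (8 * z) ^ (-2 : ℤ)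
        = ∑' m : ℕ, (a2 (m + 1) : ℂ) * Complex.exp (2 * Real.pi * Complex.I * z) ^ (m + 1))
    (n : ℕ) (hn : 0 < n) :
    (repCount ![1, 1, 1, 1, 1, 2, 4, 4] n : ℚ) =
    (((32 : ℚ) / 11) * (sigmaChi8One n : ℚ) + ((2 : ℚ) / 11) * half sigmaOneChi8 n
      + ((-14 : ℚ) / 11) * (a1 n : ℚ) + ((92 : ℚ) / 11) * (a2 n : ℚ)
      + ((224 : ℚ) / 11) * half a1 n + ((192 : ℚ) / 11) * half a2 n) := by

  have key : ∀ n : ℕ, (if n = 0 then (repCount ![1, 1, 1, 1, 1, 2, 4, 4] 0 : ℝ) - 1 else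
      (repCount ![1, 1, 1, 1, 1, 2, 4, 4] n : ℝ) -
      (32 / 11 * (sigmaChi8One n : ℝ) + 2 / 11 * (half sigmaOneChi8 n : ℝ)
      + -14 / 11 * (a1 n : ℝ) + 92 / 11 * (a2 n : ℝ)
      + 224 / 11 * (half a1 n : ℝ) + 192 / 11 * (half a2 n : ℝ))) = 0 := by
    refine Rep10.coeff_unique (R := 1/4) (by norm_num) ?_
    intro q h0 h1
    have h1' : q < 1 := by linarith
    have hq := Rep10.pow_pos_lt h0 h1' 2 two_ne_zero
    have r := Rep10.shift_one (f := fun n => (repCount ![1, 1, 1, 1, 1, 2, 4, 4] n : ℝ)) (Rep10.rep_series h0 h1')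
    have sA := Rep10.shift_one (f := fun n => (sigmaChi8One n : ℝ)) (Rep10.A_value h0 h1')
    have sB := Rep10.shift_one (f := fun n => (sigmaOneChi8 n : ℝ)) (Rep10.B_lambert hq.1 hq.2).2
    have zA : ((sigmaChi8One 0 : ℤ) : ℝ) = 0 := by simp [sigmaChi8One]
    have zB : ((sigmaOneChi8 0 : ℤ) : ℝ) = 0 := by simp [sigmaOneChi8]
    rw [zA, sub_zero] at sA
    rw [zB, sub_zero] at sB
    have sB' := Rep10.half_series sB
    have s1 := Rep10.a1_value ha1 h0 h1'
    have s2 := Rep10.a2_value ha2 h0 h1'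
    have s1' := Rep10.half_series (Rep10.a1_value ha1 hq.1 hq.2)
    have s2' := Rep10.half_series (Rep10.a2_value ha2 hq.1 hq.2)
    have tot := r.sub ((((((sA.mul_left (32/11)).add (sB'.mul_left (2/11))).add (s1.mul_left (-14/11))).add
      (s2.mul_left (92/11))).add (s1'.mul_left (224/11))).add (s2'.mul_left (192/11)))
    refine (hasSum_nat_add_iff' 1).1 ?_
    refine Rep10.hasSum_of_eq tot (fun k => ?_) ?_
    · simp only [Nat.succ_ne_zero, if_false]
      ring
    · have := Rep10.final_identity h0 h1
      simp only [Finset.sum_range_one, if_true, pow_zero]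
      linarith
  have hk := key n
  rw [if_neg hn.ne', sub_eq_zero] at hk
  apply Rat.cast_injective (α := ℝ)
  push_cast
  linarith [hk]
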